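/- For all integers n ≥ 3 and 1 ≤ k ≤ n−2, the snowy twin peaks graph STP_{n+1}^{k} — the labelled graph on {1,…,n+1} in which a pair {i,j} with i < j is an edge if and only if j ≤ m_i, where m_1 = k+1, m_2 = n, and m_i = n+1 for 3 ≤ i ≤ n+1 — is appendable (e)-positive, and its reverse graph (STP_{n+1}^{k})^r is also appendable (e)-positive. -/

import Mathlib

open scoped Classical
noncomputable section

/-- Words of length `d` in the positive integers. -/
abbrev NCWord (d : ℕ) := Fin d → ℕ+

/-- `M_d`: coefficient functions of homogeneous degree-`d` series in
noncommuting variables. -/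
abbrev Md (d : ℕ) := NCWord d → ℚ

/-- `Y_G`, the chromatic symmetric function of a labelled graph in
noncommuting variables, as an element of `M_d`. -/
def YG {d : ℕ} (G : SimpleGraph (Fin d)) : Md d :=
  fun w => if ∀ j k : Fin d, G.Adj j k → w j ≠ w k then 1 else 0

/-- Set partitions of `{0, …, d-1}`. -/
abbrev SetPtn (d : ℕ) := Finpartition (Finset.univ : Finset (Fin d))

/-- `j` and `k` lie in a common block of `π`. -/
def sameBlock {d : ℕ} (π : SetPtn d) (j k : Fin d) : Prop :=
  ∃ B ∈ π.parts, j ∈ B ∧ k ∈ B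

/-- The elementary symmetric function `e_π` in noncommuting variables. -/
def eSP {d : ℕ} (π : SetPtn d) : Md d :=
  fun w => if ∀ j k : Fin d, j ≠ k → sameBlock π j k → w j ≠ w k then 1 else 0

/-- The block of `π` containing `a`. -/
def blockOf {d : ℕ} (π : SetPtn d) (a : Fin d) : Finset (Fin d) :=
  Finset.univ.filter fun k => sameBlock π a k

/-- The type of a set partition relative to the distinguished element `a`:
the multiset of sizes of the blocks not containing `a` (an integer partition),
together with the size of the block containing `a`. -/
def ptype {d : ℕ} (π : SetPtn d) (a : Fin d) : Multiset ℕ × ℕ :=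
  ((π.parts.erase (blockOf π a)).val.map Finset.card, (blockOf π a).card)

/-- `K_d`: the span of the differences `e_{π₁} - e_{π₂}` over pairs of set
partitions of equal type (relative to the distinguished element `a`). -/
def Ksub {d : ℕ} (a : Fin d) : Submodule ℚ (Md d) :=
  Submodule.span ℚ
    {f | ∃ π₁ π₂ : SetPtn d, ptype π₁ a = ptype π₂ a ∧ f = eSP π₁ - eSP π₂}

/-- `(e)`-positivity of a labelled graph, with distinguished vertex `a`:
`Y_G` is congruent modulo `K_d` to a nonnegative combination of `e_π`'s. -/
def IsEPosNCAt {d : ℕ} (G : SimpleGraph (Fin d)) (a : Fin d) : Prop :=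
  ∃ (s : Finset (SetPtn d)) (c : SetPtn d → ℚ),
    (∀ π, 0 ≤ c π) ∧ YG G - ∑ π ∈ s, c π • eSP π ∈ Ksub a

/-- Induction `↑ : M_d → M_{d+1}`. -/
def induct {d : ℕ} (f : Md d) : Md (d + 1) :=
  fun w => if w (Fin.last d) = w ⟨d - 1, by omega⟩
    then f (fun t => w t.castSucc) else 0

/-- Concatenation of labelled graphs: identify the last vertex of `G` with
the first vertex of `H`. -/
def concatG {p q : ℕ} (G : SimpleGraph (Fin p)) (H : SimpleGraph (Fin q)) :
    SimpleGraph (Fin (p + q - 1)) :=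
  SimpleGraph.fromRel fun a b =>
    (∃ i j : Fin p, G.Adj i j ∧ (a : ℕ) = (i : ℕ) ∧ (b : ℕ) = (j : ℕ)) ∨
    (∃ i j : Fin q, H.Adj i j ∧ (a : ℕ) = (i : ℕ) + (p - 1) ∧ (b : ℕ) = (j : ℕ) + (p - 1))

/-- The reverse graph `G^r`. -/
def revG {d : ℕ} (G : SimpleGraph (Fin d)) : SimpleGraph (Fin d) :=
  SimpleGraph.comap (fun i : Fin d => (⟨d - 1 - (i : ℕ), by have := i.isLt; omega⟩ : Fin d)) G

/-- A labelled graph: a simple graph on vertex set `{0, …, n-1}`, `n ≥ 1`. -/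
structure LGraph where
  n : ℕ
  npos : 0 < n
  G : SimpleGraph (Fin n)

/-- The last vertex of a labelled graph. -/
def LGraph.last (A : LGraph) : Fin A.n := ⟨A.n - 1, by have := A.npos; omega⟩

/-- A labelled graph is `(e)`-positive (at its last vertex). -/
def LGraph.EPosNC (A : LGraph) : Prop := IsEPosNCAt A.G A.last

/-- Concatenation, as an operation on labelled graphs. -/
def LGraph.concat (A B : LGraph) : LGraph :=
  ⟨A.n + B.n - 1, by have := A.npos; have := B.npos; omega, concatG A.G B.G⟩

/-- Reversal, as an operation on labelled graphs. -/
def LGraph.rev (A : LGraph) : LGraph := ⟨A.n, A.npos, revG A.G⟩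

/-- Appendable `(e)`-positivity: `G + H` is `(e)`-positive for every
`(e)`-positive labelled graph `G`. -/
def LGraph.Appendable (H : LGraph) : Prop :=
  ∀ A : LGraph, A.EPosNC → (A.concat H).EPosNC

/-- The chromatic symmetric polynomial of `G` in `n` commuting variables. -/
def cspoly {V : Type} [Fintype V] [DecidableEq V] (G : SimpleGraph V) (n : ℕ) :
    MvPolynomial (Fin n) ℚ :=
  ∑ κ ∈ Finset.univ.filter (fun κ : V → Fin n => ∀ u v : V, G.Adj u v → κ u ≠ κ v),
    ∏ v : V, MvPolynomial.X (κ v)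

/-- `e`-positivity of a finite graph. -/
def EPos {V : Type} [Fintype V] [DecidableEq V] (G : SimpleGraph V) : Prop :=
  ∃ c : Nat.Partition (Fintype.card V) → ℚ, (∀ p, 0 ≤ c p) ∧
    ∀ n : ℕ, cspoly G n =
      ∑ p : Nat.Partition (Fintype.card V),
        c p • (p.parts.map fun r => MvPolynomial.esymm (Fin n) ℚ r).prod

/-- Closed neighbourhood of a vertex, as a finset. -/
def closedNbhd {d : ℕ} (G : SimpleGraph (Fin d)) (i : Fin d) : Finset (Fin d) :=
  Finset.univ.filter fun k => k = i ∨ G.Adj i k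

/-- `m_i`: the largest label in the closed neighbourhood of `i`. -/
def mIdx {d : ℕ} (G : SimpleGraph (Fin d)) (i : Fin d) : Fin d :=
  (closedNbhd G i).max' ⟨i, by simp [closedNbhd]⟩

/-- `w_i`: the smallest label in the closed neighbourhood of `i`. -/
def wIdx {d : ℕ} (G : SimpleGraph (Fin d)) (i : Fin d) : Fin d :=
  (closedNbhd G i).min' ⟨i, by simp [closedNbhd]⟩

/-- Labelled unit interval graph. -/
def IsUnitInterval {d : ℕ} (G : SimpleGraph (Fin d)) : Prop :=
  ∀ i v w j : Fin d, i ≤ v → v < w → w ≤ j → G.Adj i j → G.Adj v w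

/-- An acyclic orientation of a graph, as an asymmetric relation with
irreflexive transitive closure whose symmetrization matches adjacency. -/
def IsAcyclicOrientation {V : Type} (G : SimpleGraph V) (r : V → V → Prop) : Prop :=
  (∀ a b, r a b → ¬ r b a) ∧
  (∀ a b, a ≠ b → ((r a b ∨ r b a) ↔ G.Adj a b)) ∧
  Irreflexive (Relation.TransGen r)

/-- The set of sinks of an orientation. -/
def sinkSet {V : Type} [Fintype V] (r : V → V → Prop) : Finset V :=
  Finset.univ.filter fun x => ∀ y, ¬ r x y

/-- The labelled path `P_d`. -/
def PathG (d : ℕ) : SimpleGraph (Fin d) :=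
  SimpleGraph.fromRel fun a b => (b : ℕ) = (a : ℕ) + 1

/-- The labelled cycle `C_d`. -/
def CycleG (d : ℕ) : SimpleGraph (Fin d) :=
  SimpleGraph.fromRel fun a b => (b : ℕ) = (a : ℕ) + 1 ∨ ((a : ℕ) = 0 ∧ (b : ℕ) = d - 1)

/-- The snowy twin peaks graph `STP_{n+1}^{k}` (0-indexed labels): `{a, b}`
with `a < b` is an edge iff `b ≤ m_a`, where `m_0 = k`, `m_1 = n - 1` and
`m_a = n` for `a ≥ 2`. -/
def STPgraph (n k : ℕ) : SimpleGraph (Fin (n + 1)) :=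
  SimpleGraph.fromRel fun a b => (a : ℕ) < (b : ℕ) ∧
    (b : ℕ) ≤ (if (a : ℕ) = 0 then k else if (a : ℕ) = 1 then n - 1 else n)

/-- Sums over words factor along the fibres of a map on positions. -/
theorem sum_prod_fibers {V Q A R : Type*} [Fintype V] [DecidableEq V] [Fintype Q]
    [DecidableEq Q] [Fintype A] [CommSemiring R] (f : V → Q) (F : ∀ q, ({i // f i = q} → A) → R) :
    ∑ w : V → A, ∏ q, F q (fun i => w i.1) = ∏ q, ∑ v : {i // f i = q} → A, F q v := by
  rw [Finset.prod_univ_sum, Fintype.piFinset_univ]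
  refine Fintype.sum_equiv (Equiv.piCongrFiberwise (f := f) (γ₁ := fun _ => A)
    (γ₂ := fun q => ({i // f i = q} → A)) (fun q => Equiv.refl _)) _ _ ?_
  intro w
  rfl

/-- The indicator of words that are constant on the classes of `r`. -/
def constInd {V A : Type*} (r : Setoid V) (w : V → A) : ℚ :=
  if r ≤ Setoid.ker w then 1 else 0

/-- The indicator of words that separate every pair in `S`. -/
def sepInd {V A : Type*} (S : Finset (V × V)) (w : V → A) : ℚ :=
  if ∀ e ∈ S, w e.1 ≠ w e.2 then 1 else 0

/-- The equivalence relation generated by a finite set of pairs. -/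
def pairsSetoid {V : Type*} (F : Finset (V × V)) : Setoid V :=
  Relation.EqvGen.setoid fun i j => (i, j) ∈ F

theorem pairsSetoid_le {V : Type*} (F : Finset (V × V)) (s : Setoid V) :
    pairsSetoid F ≤ s ↔ ∀ e ∈ F, s e.1 e.2 := by
  constructor
  · intro h e he
    exact h (Relation.EqvGen.rel _ _ he)
  · intro h
    exact Setoid.eqvGen_le fun x y hxy => h (x, y) hxy

theorem sepInd_eq_sum {V A : Type*} (S : Finset (V × V)) (w : V → A) :
    sepInd S w = ∑ F ∈ S.powerset, (-1 : ℚ) ^ F.card * constInd (pairsSetoid F) w := by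
  have h1 : sepInd S w = ∏ e ∈ S, ((1 : ℚ) - if w e.1 = w e.2 then 1 else 0) := by
    unfold sepInd
    split_ifs with h
    · symm
      apply Finset.prod_eq_one
      intro e he
      simp [h e he]
    · push Not at h
      obtain ⟨e, he, h⟩ := h
      symm
      apply Finset.prod_eq_zero he
      simp [h]
  rw [h1, Finset.prod_sub]
  refine Finset.sum_congr rfl fun F _ => ?_
  simp only [Finset.prod_const_one, mul_one]
  congr 1
  unfold constInd
  rw [pairsSetoid_le]
  simp only [Setoid.ker_def]
  rw [Finset.prod_ite_zero]
  simp

theorem sum_constInd {V : Type*} [Fintype V] (r : Setoid V) (q : ℕ) :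
    ∑ w : V → Fin q, constInd r w = (q : ℚ) ^ Fintype.card (Quotient r) := by
  unfold constInd
  rw [Finset.sum_boole, ← Fintype.card_subtype, Fintype.card_congr (Setoid.liftEquiv r)]
  simp

theorem card_quotient_lt {V : Type*} [Fintype V] {r s : Setoid V} (h : r < s) :
    Fintype.card (Quotient s) < Fintype.card (Quotient r) := by
  have hle : r ≤ s := h.le
  let g : Quotient r → Quotient s := Quotient.map' id fun a b hab => hle hab
  have hg : Function.Surjective g := by
    intro x
    induction x using Quotient.inductionOn with
    | h a => exact ⟨Quotient.mk _ a, rfl⟩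
  refine lt_of_le_of_ne (Fintype.card_le_of_surjective g hg) fun hc => ?_
  have hb : Function.Bijective g :=
    (Fintype.bijective_iff_surjective_and_card g).2 ⟨hg, hc.symm⟩
  refine h.not_ge fun a b hab => ?_
  exact Quotient.exact (hb.1 (Quotient.sound hab : g (Quotient.mk _ a) = g (Quotient.mk _ b)))

/-- The pairs of distinct equivalent elements. -/
def relPairs {V : Type*} [Fintype V] (r : Setoid V) : Finset (V × V) :=
  Finset.univ.filter fun e => e.1 ≠ e.2 ∧ r e.1 e.2

theorem sum_boole_injective (ι : Type*) [Fintype ι] [DecidableEq ι] (q : ℕ) :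
    ∑ v : ι → Fin q, (if Function.Injective v then (1 : ℚ) else 0)
      = (q.descFactorial (Fintype.card ι) : ℚ) := by
  rw [Finset.sum_boole, ← Fintype.card_subtype,
    Fintype.card_congr (Equiv.subtypeInjectiveEquivEmbedding ι (Fin q)), Fintype.card_embedding_eq]
  simp

theorem sum_sepInd_relPairs {V : Type*} [Fintype V] (r : Setoid V) (q : ℕ) :
    ∑ w : V → Fin q, sepInd (relPairs r) w
      = ∏ c : Quotient r,
        (q.descFactorial (Fintype.card {i // (Quotient.mk r i) = c}) : ℚ) := by
  refine Eq.trans ?_ ((sum_prod_fibers (f := fun i => Quotient.mk r i)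
    (F := fun c (v : _ → Fin q) => if Function.Injective v then (1 : ℚ) else 0)).trans
    (Finset.prod_congr rfl fun c _ => sum_boole_injective _ q))
  refine Finset.sum_congr rfl fun w _ => ?_
  rw [Finset.prod_ite_zero]
  unfold sepInd
  simp only [Finset.prod_const_one]
  congr 1
  simp only [relPairs, Finset.mem_filter, Finset.mem_univ, true_and, eq_iff_iff, true_implies]
  constructor
  · rintro h c ⟨i, hi⟩ ⟨j, hj⟩ hij
    by_contra hne
    exact h (i, j) ⟨fun e => hne (Subtype.ext e), Quotient.exact (hi.trans hj.symm)⟩ hij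
  · rintro h ⟨i, j⟩ ⟨hne, hr⟩ hij
    have := @h (Quotient.mk r j) ⟨i, Quotient.sound hr⟩ ⟨j, rfl⟩ hij
    exact hne (congrArg Subtype.val this)

/-- Whitney's coefficient of the coarsest term does not vanish. -/
theorem whitney_coeff_ne_zero {V : Type*} [Fintype V] (r : Setoid V) :
    ∑ F ∈ (relPairs r).powerset with pairsSetoid F = r, (-1 : ℚ) ^ F.card ≠ 0 := by
  intro h0
  obtain ⟨q, hq, hp⟩ := Nat.exists_infinite_primes (Fintype.card V + 1)
  set c := Fintype.card (Quotient r) with hc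
  have hle : ∀ F ∈ (relPairs r).powerset, pairsSetoid F ≤ r := by
    intro F hF
    rw [pairsSetoid_le]
    intro e he
    have := Finset.mem_powerset.1 hF he
    simp only [relPairs, Finset.mem_filter] at this
    exact this.2.2
  have key : ∑ w : V → Fin q, sepInd (relPairs r) w =
      ∑ F ∈ (relPairs r).powerset with ¬ pairsSetoid F = r,
        (-1 : ℚ) ^ F.card * (q : ℚ) ^ Fintype.card (Quotient (pairsSetoid F)) := by
    simp_rw [sepInd_eq_sum]
    rw [Finset.sum_comm]
    simp_rw [← Finset.mul_sum, sum_constInd]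
    rw [← Finset.sum_filter_add_sum_filter_not _ (fun F => pairsSetoid F = r)]
    rw [Finset.sum_congr (g := fun F => (-1 : ℚ) ^ F.card * (q : ℚ) ^ c) rfl]
    · rw [← Finset.sum_mul, h0, zero_mul, zero_add]
    · intro F hF
      rw [(Finset.mem_filter.1 hF).2]
  rw [sum_sepInd_relPairs] at key
  have hpos : ∀ b : Quotient r, ∃ m, Fintype.card {i // (Quotient.mk r i) = b} = m + 1 := by
    intro b
    have : 0 < Fintype.card {i // (Quotient.mk r i) = b} := by
      induction b using Quotient.inductionOn with
      | h a => exact Fintype.card_pos_iff.2 ⟨⟨a, rfl⟩⟩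
    exact ⟨_, (Nat.succ_pred_eq_of_pos this).symm⟩
  choose m hm using hpos
  have hdvd : (q : ℤ) ^ (c + 1) ∣ ∏ b : Quotient r,
      (q.descFactorial (Fintype.card {i // (Quotient.mk r i) = b}) : ℤ) := by
    have : (∏ b : Quotient r, (q.descFactorial (Fintype.card {i // (Quotient.mk r i) = b}) : ℤ)) =
      ∑ F ∈ (relPairs r).powerset with ¬ pairsSetoid F = r,
        (-1 : ℤ) ^ F.card * (q : ℤ) ^ Fintype.card (Quotient (pairsSetoid F)) := by
      exact_mod_cast key
    rw [this]
    refine Finset.dvd_sum fun F hF => Dvd.dvd.mul_left (pow_dvd_pow _ ?_) _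
    obtain ⟨h1, h2⟩ := Finset.mem_filter.1 hF
    exact card_quotient_lt (lt_of_le_of_ne (hle F h1) h2)
  have hdvd2 : q ^ (c + 1) ∣ ∏ b : Quotient r,
      (q.descFactorial (Fintype.card {i // (Quotient.mk r i) = b})) := by exact_mod_cast hdvd
  have hq1 : q = (q - 1) + 1 := by have := hp.pos; omega
  have hfac : ∀ b : Quotient r, q.descFactorial (Fintype.card {i // (Quotient.mk r i) = b})
      = q * (q - 1).descFactorial (m b) := by
    intro b
    rw [hm b]
    conv_lhs => rw [hq1]
    rw [Nat.succ_descFactorial_succ, ← hq1]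
  simp_rw [hfac] at hdvd2
  rw [Finset.prod_mul_distrib, Finset.prod_const, Finset.card_univ, ← hc, pow_succ,
    Nat.mul_dvd_mul_iff_left (pow_pos hp.pos _), hp.prime.dvd_finsetProd_iff] at hdvd2
  obtain ⟨b, -, hb⟩ := hdvd2
  have hmb : m b ≤ q - 1 := by
    have := Fintype.card_subtype_le fun i => Quotient.mk r i = b
    rw [hm b] at this
    omega
  have := hb.trans (Dvd.intro_left _ (Nat.factorial_mul_descFactorial hmb))
  rw [hp.dvd_factorial] at this
  have := hp.pos
  omega

theorem sameBlock_ofSetoid {d : ℕ} (r : Setoid (Fin d)) (j k : Fin d) :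
    sameBlock (Finpartition.ofSetoid r) j k ↔ r j k := by
  rw [← Finpartition.mem_part_ofSetoid_iff_rel, Finpartition.mem_part_iff_exists]
  constructor
  · rintro ⟨B, h, h1, h2⟩
    exact ⟨B, h, h2, h1⟩
  · rintro ⟨B, h, h1, h2⟩
    exact ⟨B, h, h2, h1⟩

theorem eSP_ofSetoid {d : ℕ} (r : Setoid (Fin d)) :
    eSP (Finpartition.ofSetoid r) = fun w => sepInd (relPairs r) w := by
  funext w
  unfold eSP sepInd
  congr 1
  simp [relPairs, sameBlock_ofSetoid]

/-- The span of the elementary functions `e_π`. -/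
def eSpan (d : ℕ) : Submodule ℚ (Md d) := Submodule.span ℚ (Set.range (eSP (d := d)))

theorem sepInd_fun_eq_sum {d : ℕ} (S : Finset (Fin d × Fin d)) :
    (fun w => sepInd S w : Md d) =
      ∑ F ∈ S.powerset, (-1 : ℚ) ^ F.card • (fun w => constInd (pairsSetoid F) w : Md d) := by
  funext w
  rw [sepInd_eq_sum, Finset.sum_apply]
  simp

theorem constInd_mem_eSpan {d : ℕ} (r : Setoid (Fin d)) :
    (fun w => constInd r w : Md d) ∈ eSpan d := by
  have : Finite (Setoid (Fin d)) :=
    Finite.of_injective (fun r : Setoid (Fin d) => (r : Fin d → Fin d → Prop))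
      fun r s h => Setoid.ext fun a b => iff_of_eq (congrFun₂ h a b)
  induction r using WellFoundedLT.induction with
  | ind r ih =>
  have h := sepInd_fun_eq_sum (relPairs r)
  rw [← Finset.sum_filter_add_sum_filter_not _ (fun F => pairsSetoid F = r)] at h
  rw [Finset.sum_congr (g := fun F => (-1 : ℚ) ^ F.card • (fun w => constInd r w : Md d)) rfl
    (fun F hF => by rw [(Finset.mem_filter.1 hF).2]), ← Finset.sum_smul, ← sub_eq_iff_eq_add] at h
  rw [← Submodule.smul_mem_iff _ (whitney_coeff_ne_zero r), ← h]
  refine Submodule.sub_mem _ ?_ (Submodule.sum_mem _ fun F hF => Submodule.smul_mem _ _ (ih _ ?_))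
  · rw [← eSP_ofSetoid]
    exact Submodule.subset_span ⟨_, rfl⟩
  · obtain ⟨h1, h2⟩ := Finset.mem_filter.1 hF
    refine lt_of_le_of_ne ?_ h2
    rw [pairsSetoid_le]
    intro e he
    have := Finset.mem_powerset.1 h1 he
    simp only [relPairs, Finset.mem_filter] at this
    exact this.2.2

theorem YG_mem_eSpan {d : ℕ} (G : SimpleGraph (Fin d)) : YG G ∈ eSpan d := by
  have h : YG G = fun w => sepInd (Finset.univ.filter fun e : Fin d × Fin d => G.Adj e.1 e.2) w := by
    funext w
    unfold YG sepInd
    simp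
  rw [h, sepInd_fun_eq_sum]
  exact Submodule.sum_mem _ fun F _ => Submodule.smul_mem _ _ (constInd_mem_eSpan _)

/-- The action of a permutation of positions on coefficient functions. -/
def permAct {d : ℕ} (τ : Equiv.Perm (Fin d)) : Md d →ₗ[ℚ] Md d :=
  LinearMap.funLeft ℚ ℚ fun w : NCWord d => w ∘ τ

/-- The order isomorphism of finsets induced by a permutation. -/
def finsetPermIso {V : Type*} (τ : Equiv.Perm V) : Finset V ≃o Finset V where
  toEquiv := τ.finsetCongr
  map_rel_iff' := by
    intro s t
    simp [Equiv.finsetCongr]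

/-- The image of a set partition under a permutation of positions. -/
def permPtn {d : ℕ} (τ : Equiv.Perm (Fin d)) (π : SetPtn d) : SetPtn d :=
  (π.map (finsetPermIso τ)).copy (by simp [finsetPermIso])

theorem permPtn_parts {d : ℕ} (τ : Equiv.Perm (Fin d)) (π : SetPtn d) :
    (permPtn τ π).parts = π.parts.map (finsetPermIso τ).toEquiv.toEmbedding := rfl

theorem mem_finsetPermIso {V : Type*} (τ : Equiv.Perm V) (B : Finset V) (i : V) :
    τ i ∈ finsetPermIso τ B ↔ i ∈ B := by
  simp [finsetPermIso]

theorem sameBlock_permPtn {d : ℕ} (τ : Equiv.Perm (Fin d)) (π : SetPtn d) (j k : Fin d) :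
    sameBlock (permPtn τ π) (τ j) (τ k) ↔ sameBlock π j k := by
  unfold sameBlock
  rw [permPtn_parts]
  constructor
  · rintro ⟨B, hB, h1, h2⟩
    obtain ⟨B, hB', rfl⟩ := Finset.mem_map.1 hB
    exact ⟨B, hB', (mem_finsetPermIso τ B j).1 h1, (mem_finsetPermIso τ B k).1 h2⟩
  · rintro ⟨B, hB, h1, h2⟩
    exact ⟨finsetPermIso τ B, Finset.mem_map_of_mem _ hB, (mem_finsetPermIso τ B j).2 h1,
      (mem_finsetPermIso τ B k).2 h2⟩

theorem permAct_eSP {d : ℕ} (τ : Equiv.Perm (Fin d)) (π : SetPtn d) :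
    permAct τ (eSP π) = eSP (permPtn τ π) := by
  funext w
  change eSP π (w ∘ τ) = _
  unfold eSP
  congr 1
  rw [eq_iff_iff]
  constructor
  · intro h j k
    obtain ⟨j, rfl⟩ := τ.surjective j
    obtain ⟨k, rfl⟩ := τ.surjective k
    rw [sameBlock_permPtn]
    exact fun hjk => h j k fun e => hjk (congrArg τ e)
  · intro h j k hjk hb
    exact h (τ j) (τ k) (fun e => hjk (τ.injective e)) ((sameBlock_permPtn τ π j k).2 hb)

theorem ptype_permPtn {d : ℕ} (τ : Equiv.Perm (Fin d)) (π : SetPtn d) (a : Fin d) (ha : τ a = a) :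
    ptype (permPtn τ π) a = ptype π a := by
  have hb : blockOf (permPtn τ π) a = finsetPermIso τ (blockOf π a) := by
    ext k
    obtain ⟨k, rfl⟩ := τ.surjective k
    rw [mem_finsetPermIso]
    simp only [blockOf, Finset.mem_filter, Finset.mem_univ, true_and]
    conv_lhs => rw [← ha]
    exact sameBlock_permPtn τ π a k
  have hcard : ∀ B : Finset (Fin d), (finsetPermIso τ B).card = B.card := by
    intro B
    simp [finsetPermIso]
  unfold ptype
  rw [hb, hcard]
  congr 1
  rw [permPtn_parts]
  have : (π.parts.map (finsetPermIso τ).toEquiv.toEmbedding).erase (finsetPermIso τ (blockOf π a))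
      = (π.parts.erase (blockOf π a)).map (finsetPermIso τ).toEquiv.toEmbedding :=
    (Finset.map_erase _ _ _).symm
  rw [this, Finset.map_val, Multiset.map_map]
  exact Multiset.map_congr rfl fun B _ => hcard B

theorem sub_permAct_mem_Ksub {d : ℕ} {a : Fin d} {τ : Equiv.Perm (Fin d)} (ha : τ a = a)
    {f : Md d} (hf : f ∈ eSpan d) : f - permAct τ f ∈ Ksub a := by
  unfold eSpan at hf
  induction hf using Submodule.span_induction with
  | mem f h =>
    obtain ⟨π, rfl⟩ := h
    exact Submodule.subset_span ⟨π, permPtn τ π, (ptype_permPtn τ π a ha).symm, by rw [permAct_eSP]⟩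
  | zero => simp
  | add f g _ _ hf hg =>
    rw [map_add, add_sub_add_comm]
    exact Submodule.add_mem _ hf hg
  | smul r f _ hf =>
    rw [map_smul, ← smul_sub]
    exact Submodule.smul_mem _ _ hf

/-- The generating function of `f` over the words whose letter at `a` is `c`, with letter weights
`x` at all other positions. -/
def markedSum {d : ℕ} {A R : Type*} [Fintype A] [CommRing R] [Algebra ℚ R]
    (col : A → ℕ+) (x : A → R) (a : Fin d) (c : A) : Md d →ₗ[ℚ] R where
  toFun f := ∑ w : Fin d → A,
    if w a = c then f (fun i => col (w i)) • ∏ i ∈ Finset.univ.erase a, x (w i) else 0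
  map_add' f g := by
    rw [← Finset.sum_add_distrib]
    refine Finset.sum_congr rfl fun w _ => ?_
    split_ifs <;> simp [add_smul]
  map_smul' r f := by
    rw [Finset.smul_sum]
    refine Finset.sum_congr rfl fun w _ => ?_
    split_ifs <;> simp [mul_smul]

theorem markedSum_apply {d : ℕ} {A R : Type*} [Fintype A] [CommRing R] [Algebra ℚ R]
    (col : A → ℕ+) (x : A → R) (a : Fin d) (c : A) (f : Md d) :
    markedSum col x a c f = ∑ w : Fin d → A,
      if w a = c then f (fun i => col (w i)) • ∏ i ∈ Finset.univ.erase a, x (w i) else 0 := rfl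

theorem markedSum_polarized {d : ℕ} (a : Fin d) (w₀ : NCWord d) (f : Md d) :
    markedSum (A := Set.range w₀) Subtype.val
        (fun z => ∑ j with w₀ j = z, (MvPolynomial.X j : MvPolynomial (Fin d) ℚ)) a
        ⟨w₀ a, a, rfl⟩ f
      = ∑ u : Fin d → Fin d, if u a = a then
          f (w₀ ∘ u) • ∏ i ∈ Finset.univ.erase a, (MvPolynomial.X (u i) : MvPolynomial (Fin d) ℚ)
        else 0 := by
  rw [markedSum_apply,
    ← Finset.sum_fiberwise (g := fun (u : Fin d → Fin d) i => (⟨w₀ (u i), u i, rfl⟩ : Set.range w₀))]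
  refine Finset.sum_congr rfl fun w _ => ?_
  have hL : ∀ u : Fin d → Fin d, (fun i => (⟨w₀ (u i), u i, rfl⟩ : Set.range w₀)) = w ↔
      ∀ i, w₀ (u i) = w i := by
    intro u
    rw [funext_iff]
    exact forall_congr' fun i => Subtype.ext_iff
  split_ifs with hw
  · have hwa : (w a : ℕ+) = w₀ a := congrArg Subtype.val hw
    have hprod : ∏ i ∈ Finset.univ.erase a,
        ∑ j with w₀ j = w i, (MvPolynomial.X j : MvPolynomial (Fin d) ℚ) =
        ∏ i, ∑ j ∈ (if i = a then {a} else Finset.univ.filter fun j => w₀ j = w i),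
          if i = a then 1 else (MvPolynomial.X j : MvPolynomial (Fin d) ℚ) := by
      rw [← Finset.mul_prod_erase _ _ (Finset.mem_univ a)]
      simp only [if_true, Finset.sum_singleton, one_mul]
      refine Finset.prod_congr rfl fun i hi => ?_
      simp [Finset.ne_of_mem_erase hi]
    rw [hprod, Finset.prod_univ_sum, Finset.smul_sum, ← Finset.sum_filter, Finset.filter_filter]
    refine Finset.sum_congr ?_ fun u hu => ?_
    · ext u
      simp only [Fintype.mem_piFinset, Finset.mem_filter, Finset.mem_univ, true_and, hL]
      constructor
      · intro h
        have ha : u a = a := by simpa using h a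
        refine ⟨fun i => ?_, ha⟩
        by_cases hi : i = a
        · rw [hi, ha, hwa]
        · simpa [hi] using h i
      · rintro ⟨h, ha⟩ i
        by_cases hi : i = a
        · simp [hi, ha]
        · simpa [hi] using h i
    · simp only [Finset.mem_filter, Finset.mem_univ, true_and, hL] at hu
      congr 1
      · congr 1
        funext i
        exact (hu.1 i).symm
      · rw [← Finset.mul_prod_erase _ _ (Finset.mem_univ a)]
        simp only [if_true, one_mul]
        refine Finset.prod_congr rfl fun i hi => ?_
        simp [Finset.ne_of_mem_erase hi]
  · symm
    apply Finset.sum_eq_zero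
    intro u hu
    simp only [Finset.mem_filter, Finset.mem_univ, true_and, hL] at hu
    rw [if_neg]
    intro ha
    apply hw
    apply Subtype.ext
    rw [← hu a, ha]

theorem coeff_prod_X_comp {V : Type*} [Fintype V] (u : V → V) :
    MvPolynomial.coeff (Finsupp.equivFunOnFinite.symm fun _ => 1)
      (∏ i, (MvPolynomial.X (u i) : MvPolynomial V ℚ)) = if Function.Bijective u then 1 else 0 := by
  have h1 : ∏ i, (MvPolynomial.X (u i) : MvPolynomial V ℚ) =
      MvPolynomial.monomial (∑ i, Finsupp.single (u i) 1) 1 := by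
    simp only [MvPolynomial.X]
    rw [MvPolynomial.monomial_sum_one]
  rw [h1, MvPolynomial.coeff_monomial]
  congr 1
  rw [eq_iff_iff, Finsupp.ext_iff]
  have h2 : ∀ j, (∑ i, Finsupp.single (u i) 1 : V →₀ ℕ) j = (Finset.univ.filter fun i => u i = j).card := by
    intro j
    rw [Finsupp.finsetSum_apply, Finset.card_filter]
    exact Finset.sum_congr rfl fun i _ => Finsupp.single_apply
  simp only [h2, Finsupp.equivFunOnFinite_symm_apply_apply]
  constructor
  · intro h
    rw [← Finite.surjective_iff_bijective]
    intro j
    obtain ⟨i, hi⟩ := Finset.card_pos.1 (by rw [h j]; exact one_pos)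
    exact ⟨i, by simpa using hi⟩
  · intro h j
    obtain ⟨i, rfl⟩ := h.2 j
    rw [Finset.card_eq_one]
    exact ⟨i, by ext k; simp [h.1.eq_iff]⟩

theorem mem_Ksub_of_markedSum_eq_zero {d : ℕ} (a : Fin d) {f : Md d} (hf : f ∈ eSpan d)
    (h : ∀ (A : Type) [Fintype A] (col : A → ℕ+) (x : A → MvPolynomial (Fin d) ℚ) (c : A),
      Function.Injective col → markedSum col x a c f = 0) : f ∈ Ksub a := by
  have hzero : ∑ τ : Equiv.Perm (Fin d) with τ a = a, permAct τ f = 0 := by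
    funext w₀
    have h0 := h (Set.range w₀) Subtype.val
      (fun z => ∑ j with w₀ j = z, (MvPolynomial.X j : MvPolynomial (Fin d) ℚ))
      ⟨w₀ a, a, rfl⟩ Subtype.val_injective
    rw [markedSum_polarized] at h0
    have h1 := congrArg (fun p => MvPolynomial.coeff (Finsupp.equivFunOnFinite.symm fun _ => 1)
      (MvPolynomial.X a * p)) h0
    simp only [mul_zero, MvPolynomial.coeff_zero, Finset.mul_sum, MvPolynomial.coeff_sum] at h1
    rw [Finset.sum_apply, Pi.zero_apply, ← h1, Finset.sum_filter]
    have h2 : ∀ u : Fin d → Fin d,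
        MvPolynomial.coeff (Finsupp.equivFunOnFinite.symm fun _ => 1)
          (MvPolynomial.X a * if u a = a then f (w₀ ∘ u) • ∏ i ∈ Finset.univ.erase a,
            (MvPolynomial.X (u i) : MvPolynomial (Fin d) ℚ) else 0)
          = if Function.Bijective u then (if u a = a then f (w₀ ∘ u) else 0) else 0 := by
      intro u
      have hX : u a = a → MvPolynomial.X a * ∏ i ∈ Finset.univ.erase a,
          (MvPolynomial.X (u i) : MvPolynomial (Fin d) ℚ) = ∏ i, MvPolynomial.X (u i) := by
        intro hu
        rw [← Finset.mul_prod_erase _ _ (Finset.mem_univ a), hu]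
      split_ifs with hu hb hb
      · rw [mul_smul_comm, MvPolynomial.coeff_smul, hX hu,
          coeff_prod_X_comp, if_pos hb]
        simp
      · rw [mul_smul_comm, MvPolynomial.coeff_smul, hX hu,
          coeff_prod_X_comp, if_neg hb]
        simp
      · simp
      · simp
    simp_rw [h2]
    conv_rhs => rw [← Finset.sum_filter]
    refine Finset.sum_bij' (fun τ _ => (τ : Fin d → Fin d))
      (fun u hu => Equiv.ofBijective u (Finset.mem_filter.1 hu).2) ?_ ?_ ?_ ?_ ?_
    · intro τ _
      exact Finset.mem_filter.2 ⟨Finset.mem_univ _, τ.bijective⟩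
    · simp
    · intro τ _
      ext i
      rfl
    · intro u hu
      rfl
    · intro τ _
      rfl
  have hcard : (Finset.univ.filter fun τ : Equiv.Perm (Fin d) => τ a = a).card ≠ 0 := by
    rw [Finset.card_ne_zero]
    exact ⟨1, by simp⟩
  have hsum : ((Finset.univ.filter fun τ : Equiv.Perm (Fin d) => τ a = a).card : ℚ) • f =
      ∑ τ : Equiv.Perm (Fin d) with τ a = a, (f - permAct τ f) := by
    rw [Finset.sum_sub_distrib, hzero, sub_zero, Finset.sum_const, Nat.cast_smul_eq_nsmul]
  rw [← Submodule.smul_mem_iff _ (Nat.cast_ne_zero.2 hcard : (_ : ℚ) ≠ 0), hsum]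
  exact Submodule.sum_mem _ fun τ hτ => sub_permAct_mem_Ksub (Finset.mem_filter.1 hτ).2 hf

/-- The elementary symmetric polynomial of degree `m` in the values of `x` on `D`. -/
def esum {A R : Type*} [CommRing R] (x : A → R) (D : Finset A) (m : ℕ) : R :=
  ∑ t ∈ D.powersetCard m, ∏ i ∈ t, x i

theorem esum_zero {A R : Type*} [CommRing R] (x : A → R) (D : Finset A) : esum x D 0 = 1 := by
  simp [esum]

theorem esum_succ {A R : Type*} [CommRing R] (x : A → R) {D : Finset A} {c : A} (hc : c ∈ D)
    (m : ℕ) : esum x D (m + 1) = esum x (D.erase c) (m + 1) + x c * esum x (D.erase c) m := by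
  unfold esum
  have hnot : c ∉ D.erase c := Finset.notMem_erase c D
  conv_lhs => rw [← Finset.insert_erase hc]
  rw [Finset.powersetCard_succ_insert hnot, Finset.sum_union, Finset.sum_image, Finset.mul_sum]
  · congr 1
    refine Finset.sum_congr rfl fun t ht => ?_
    rw [Finset.prod_insert]
    exact fun h => hnot ((Finset.mem_powersetCard.1 ht).1 h)
  · intro s hs t ht hst
    have hs' : c ∉ s := fun h => hnot ((Finset.mem_powersetCard.1 hs).1 h)
    have ht' : c ∉ t := fun h => hnot ((Finset.mem_powersetCard.1 ht).1 h)
    rw [← Finset.erase_insert hs', ← Finset.erase_insert ht']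
    exact congrArg (fun u => u.erase c) hst
  · rw [Finset.disjoint_left]
    intro t ht ht'
    obtain ⟨s, _, rfl⟩ := Finset.mem_image.1 ht'
    exact hnot ((Finset.mem_powersetCard.1 ht).1 (Finset.mem_insert_self c s))

theorem esum_of_card_lt {A R : Type*} [CommRing R] (x : A → R) {D : Finset A} {m : ℕ}
    (h : D.card < m) : esum x D m = 0 := by
  rw [esum, Finset.powersetCard_eq_empty.2 h, Finset.sum_empty]

theorem sum_mul_esum_erase {A R : Type*} [CommRing R] (x : A → R) (D : Finset A) (m : ℕ) :
    ∑ c ∈ D, x c * esum x (D.erase c) m = (m + 1 : ℕ) * esum x D (m + 1) := by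
  induction D using Finset.induction_on generalizing m with
  | empty => rw [esum_of_card_lt x (by simp)]; simp
  | insert a D ha ih =>
    have h1 : ∀ m, esum x (insert a D) (m + 1) = esum x D (m + 1) + x a * esum x D m := by
      intro m
      rw [esum_succ x (Finset.mem_insert_self a D), Finset.erase_insert ha]
    rw [Finset.sum_insert ha, Finset.erase_insert ha, h1]
    cases m with
    | zero =>
      have := ih 0
      simp only [esum_zero] at this ⊢
      rw [this]
      push_cast
      ring
    | succ m =>
      have h2 : ∀ c ∈ D, x c * esum x ((insert a D).erase c) (m + 1) =
          x c * esum x (D.erase c) (m + 1) + x a * (x c * esum x (D.erase c) m) := by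
        intro c hc
        have hac : a ≠ c := fun h => ha (h ▸ hc)
        rw [esum_succ x (c := a) (by simp [hac]), Finset.erase_right_comm, Finset.erase_insert ha]
        ring
      rw [Finset.sum_congr rfl h2, Finset.sum_add_distrib, ← Finset.mul_sum, ih, ih]
      push_cast
      ring

theorem sum_ite_apply_eq {ι A R : Type*} [Fintype ι] [DecidableEq ι] [Fintype A] [AddCommMonoid R] (s : ι) (c : A)
    (g : (ι → A) → R) :
    (∑ v : ι → A, if v s = c then g v else 0) =
      ∑ v : {j // j ≠ s} → A, g ((Equiv.funSplitAt s A).symm (c, v)) := by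
  rw [← (Equiv.funSplitAt s A).symm.sum_comp, Fintype.sum_prod_type, Finset.sum_eq_single c]
  · refine Finset.sum_congr rfl fun v _ => ?_
    rw [if_pos]
    simp
  · intro c' _ hc'
    refine Finset.sum_eq_zero fun v _ => ?_
    rw [if_neg]
    simpa using hc'
  · simp

/-- The weight of a word with distinct letters in `D`. -/
def injWeight {ι A R : Type*} [Fintype ι] [CommRing R] (x : A → R) (D : Finset A)
    (v : ι → A) : R :=
  if Function.Injective v ∧ ∀ i, v i ∈ D then ∏ i, x (v i) else 0

theorem injective_iff_split {ι A : Type*} (s : ι) (v : ι → A) :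
    Function.Injective v ↔
      Function.Injective (fun j : {j // j ≠ s} => v j) ∧ ∀ j : {j // j ≠ s}, v j ≠ v s := by
  constructor
  · exact fun h => ⟨h.comp Subtype.val_injective, fun j hj => j.2 (h hj)⟩
  · rintro ⟨h1, h2⟩ i j hij
    by_cases hi : i = s
    · by_cases hj : j = s
      · rw [hi, hj]
      · exact absurd (by rw [← hij, hi]) (h2 ⟨j, hj⟩)
    · by_cases hj : j = s
      · exact absurd (by rw [hij, hj]) (h2 ⟨i, hi⟩)
      · exact congrArg Subtype.val (@h1 ⟨i, hi⟩ ⟨j, hj⟩ hij)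

theorem prod_eq_mul_prod_ne {ι R : Type*} [Fintype ι] [DecidableEq ι] [CommRing R] (s : ι) (f : ι → R) :
    ∏ i, f i = f s * ∏ j : {j // j ≠ s}, f j := by
  rw [← Finset.mul_prod_erase _ _ (Finset.mem_univ s)]
  congr 1
  exact Finset.prod_subtype _ (by simp) f

theorem injWeight_split {ι A R : Type*} [Fintype ι] [DecidableEq ι] [CommRing R] (x : A → R) (D : Finset A)
    (v : ι → A) (s : ι) :
    injWeight x D v =
      if v s ∈ D then x (v s) * injWeight x (D.erase (v s)) (fun j : {j // j ≠ s} => v j) else 0 := by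
  unfold injWeight
  have key : (Function.Injective v ∧ ∀ i, v i ∈ D) ↔ v s ∈ D ∧
      (Function.Injective (fun j : {j // j ≠ s} => v j) ∧
        ∀ j : {j // j ≠ s}, v j ∈ D.erase (v s)) := by
    rw [injective_iff_split s]
    simp only [Finset.mem_erase]
    constructor
    · rintro ⟨⟨h1, h2⟩, h3⟩
      exact ⟨h3 s, h1, fun j => ⟨h2 j, h3 j⟩⟩
    · rintro ⟨h1, h2, h3⟩
      refine ⟨⟨h2, fun j => (h3 j).1⟩, fun i => ?_⟩
      by_cases hi : i = s
      · rwa [hi]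
      · exact (h3 ⟨i, hi⟩).2
  rw [if_congr key rfl rfl, ite_and, prod_eq_mul_prod_ne s]
  simp only [mul_ite, mul_zero]

theorem sum_injWeight_fixed_eq {ι A R : Type*} [Fintype ι] [DecidableEq ι] [Fintype A] [CommRing R]
    (x : A → R) (D : Finset A) (s : ι) (c : A) :
    (∑ v : ι → A, if v s = c then injWeight x D v else 0) =
      if c ∈ D then x c * ∑ v : {j // j ≠ s} → A, injWeight x (D.erase c) v else 0 := by
  rw [sum_ite_apply_eq]
  have h : ∀ v : {j // j ≠ s} → A, injWeight x D ((Equiv.funSplitAt s A).symm (c, v)) =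
      if c ∈ D then x c * injWeight x (D.erase c) v else 0 := by
    intro v
    rw [injWeight_split x D _ s]
    have h1 : (Equiv.funSplitAt s A).symm (c, v) s = c := by simp
    have h2 : (fun j : {j // j ≠ s} => (Equiv.funSplitAt s A).symm (c, v) j) = v := by
      funext j
      simp [j.2]
    rw [h1, h2]
  simp_rw [h]
  split_ifs
  · rw [Finset.mul_sum]
  · simp

theorem sum_injWeight {ι A R : Type*} [Fintype ι] [DecidableEq ι] [Fintype A] [CommRing R]
    (x : A → R) (D : Finset A) {m : ℕ} (hm : Fintype.card ι = m) :
    ∑ v : ι → A, injWeight x D v = m.factorial * esum x D m := by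
  induction m generalizing ι D with
  | zero =>
    have : IsEmpty ι := Fintype.card_eq_zero_iff.1 hm
    rw [esum_zero, Fintype.sum_unique]
    simp [injWeight, Function.injective_of_subsingleton]
  | succ m ih =>
    have hne : Nonempty ι := Fintype.card_pos_iff.1 (by omega)
    obtain ⟨s⟩ := hne
    have h1 : ∀ v : ι → A, injWeight x D v = ∑ c, if v s = c then injWeight x D v else 0 := by
      intro v
      rw [Finset.sum_ite_eq, if_pos (Finset.mem_univ _)]
    have hcard : Fintype.card {j // j ≠ s} = m := by
      rw [Fintype.card_subtype_compl, Fintype.card_subtype_eq, hm]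
      rfl
    rw [Finset.sum_congr rfl fun v _ => h1 v, Finset.sum_comm]
    have h3 : ∀ c, (∑ v : ι → A, if v s = c then injWeight x D v else 0) = _ := fun c =>
      sum_injWeight_fixed_eq x D s c
    simp_rw [h3, ih _ hcard]
    rw [← Finset.sum_filter, Finset.filter_mem_eq_inter, Finset.univ_inter]
    have h2 : ∀ c ∈ D, x c * ((m.factorial : R) * esum x (D.erase c) m) =
        m.factorial * (x c * esum x (D.erase c) m) := fun c _ => by ring
    rw [Finset.sum_congr rfl h2, ← Finset.mul_sum, sum_mul_esum_erase, Nat.factorial_succ]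
    push_cast
    ring

theorem sum_injWeight_fixed {ι A R : Type*} [Fintype ι] [DecidableEq ι] [Fintype A] [CommRing R]
    (x : A → R) (D : Finset A) {m : ℕ} (hm : Fintype.card ι = m + 1) (s : ι) (c : A) :
    (∑ v : ι → A, if v s = c then injWeight x D v else 0) =
      if c ∈ D then x c * (m.factorial * esum x (D.erase c) m) else 0 := by
  have hcard : Fintype.card {j // j ≠ s} = m := by
    rw [Fintype.card_subtype_compl, Fintype.card_subtype_eq, hm]
    rfl
  rw [sum_injWeight_fixed_eq, sum_injWeight x _ hcard]

theorem sum_injWeight_avoid {ι A R : Type*} [Fintype ι] [DecidableEq ι] [Fintype A] [CommRing R]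
    (x : A → R) (D : Finset A) {m : ℕ} (hm : Fintype.card ι = m + 1) (K : Finset ι) (c : A) :
    (∑ v : ι → A, if ∀ i ∈ K, v i ≠ c then injWeight x D v else 0) =
      (m + 1).factorial * esum x D (m + 1) -
        K.card * (if c ∈ D then x c * (m.factorial * esum x (D.erase c) m) else 0) := by
  have h : ∀ v : ι → A, (if ∀ i ∈ K, v i ≠ c then injWeight x D v else 0) =
      injWeight x D v - ∑ s ∈ K, if v s = c then injWeight x D v else 0 := by
    intro v
    by_cases hv : Function.Injective v
    · split_ifs with hK
      · rw [Finset.sum_eq_zero, sub_zero]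
        exact fun s hs => if_neg (hK s hs)
      · push Not at hK
        obtain ⟨i, hi, hc⟩ := hK
        rw [Finset.sum_eq_single i, if_pos hc, sub_self]
        · intro j _ hj
          rw [if_neg]
          exact fun hj' => hj (hv (hj'.trans hc.symm))
        · exact fun h => absurd hi h
    · have h0 : injWeight x D v = 0 := if_neg fun h => hv h.1
      simp [h0]
  simp_rw [h]
  rw [Finset.sum_sub_distrib, Finset.sum_comm, sum_injWeight x D hm]
  simp_rw [sum_injWeight_fixed x D hm]
  rw [Finset.sum_const, nsmul_eq_mul]

theorem sameBlock_iff_part {d : ℕ} (π : SetPtn d) (j k : Fin d) :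
    sameBlock π j k ↔ π.part j = π.part k := by
  constructor
  · rintro ⟨B, hB, hj, hk⟩
    rw [π.part_eq_of_mem hB hj, π.part_eq_of_mem hB hk]
  · intro h
    refine ⟨π.part j, π.part_mem.2 (Finset.mem_univ j), π.mem_part (Finset.mem_univ j), ?_⟩
    rw [h]
    exact π.mem_part (Finset.mem_univ k)

theorem blockOf_eq_part {d : ℕ} (π : SetPtn d) (a : Fin d) : blockOf π a = π.part a := by
  ext k
  simp only [blockOf, Finset.mem_filter, Finset.mem_univ, true_and, sameBlock_iff_part]
  constructor
  · intro h
    rw [h]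
    exact π.mem_part (Finset.mem_univ k)
  · exact fun h => (π.part_eq_of_mem (π.part_mem.2 (Finset.mem_univ a)) h).symm

/-- The generating function of a set partition of type `(l, s + 1)`. -/
def typeGF {A R : Type*} [Fintype A] [CommRing R] (x : A → R) (c : A) (l : Multiset ℕ) (s : ℕ) : R :=
  (l.map fun j => (j.factorial : R) * esum x Finset.univ j).prod *
    (s.factorial * esum x (Finset.univ.erase c) s)

theorem sum_marked_block {ι A R : Type*} [Fintype ι] [DecidableEq ι] [Fintype A] [CommRing R]
    (x : A → R) (a : ι) (c : A) {m : ℕ} (hm : Fintype.card ι = m + 1) :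
    (∑ v : ι → A, if Function.Injective v ∧ v a = c then ∏ i, (if i = a then 1 else x (v i)) else 0) =
      m.factorial * esum x (Finset.univ.erase c) m := by
  have hcard : Fintype.card {j // j ≠ a} = m := by
    rw [Fintype.card_subtype_compl, Fintype.card_subtype_eq, hm]
    rfl
  rw [← sum_injWeight x _ hcard]
  have h1 : ∀ v : ι → A,
      (if Function.Injective v ∧ v a = c then ∏ i, (if i = a then 1 else x (v i)) else 0) =
      if v a = c then (if Function.Injective v then ∏ i, (if i = a then 1 else x (v i)) else 0)
        else 0 := by
    intro v
    rw [← ite_and]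
    exact if_congr and_comm rfl rfl
  rw [Finset.sum_congr rfl fun v _ => h1 v, sum_ite_apply_eq]
  refine Finset.sum_congr rfl fun v _ => ?_
  have h2 : (Equiv.funSplitAt a A).symm (c, v) a = c := by simp
  have h3 : ∀ j : {j // j ≠ a}, (Equiv.funSplitAt a A).symm (c, v) j = v j := by
    intro j
    simp [j.2]
  unfold injWeight
  have h4 : Function.Injective ((Equiv.funSplitAt a A).symm (c, v)) ↔
      Function.Injective v ∧ ∀ i, v i ∈ Finset.univ.erase c := by
    rw [injective_iff_split a]
    simp only [h2, h3, Finset.mem_erase, Finset.mem_univ, and_true]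
  refine if_congr h4 ?_ rfl
  rw [prod_eq_mul_prod_ne a, if_pos rfl, one_mul]
  refine Finset.prod_congr rfl fun j _ => ?_
  rw [if_neg j.2, h3]

theorem markedSum_eSP {d : ℕ} {A R : Type*} [Fintype A] [CommRing R] [Algebra ℚ R]
    {col : A → ℕ+} (hcol : Function.Injective col) (x : A → R) (a : Fin d) (c : A) (π : SetPtn d) :
    markedSum col x a c (eSP π) = typeGF x c (ptype π a).1 ((ptype π a).2 - 1) := by
  let f : Fin d → {B // B ∈ π.parts} := fun i => ⟨π.part i, π.part_mem.2 (Finset.mem_univ i)⟩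
  let F : ∀ q, ({i // f i = q} → A) → R := fun q v =>
    if Function.Injective v ∧ ∀ i, i.1 = a → v i = c then
      ∏ i, (if i.1 = a then 1 else x (v i)) else 0
  have hf : ∀ i q, f i = q ↔ i ∈ q.1 := by
    intro i q
    rw [Subtype.ext_iff]
    constructor
    · intro h
      rw [← h]
      exact π.mem_part (Finset.mem_univ i)
    · exact fun h => π.part_eq_of_mem q.2 h
  have h1 : ∀ w : Fin d → A,
      (if w a = c then eSP π (fun i => col (w i)) • ∏ i ∈ Finset.univ.erase a, x (w i) else 0) =
        ∏ q, F q (fun i => w i.1) := by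
    intro w
    simp only [F]
    rw [Finset.prod_ite_zero, Fintype.prod_fiberwise f fun i => if i = a then 1 else x (w i)]
    have hprod : ∏ i, (if i = a then 1 else x (w i)) = ∏ i ∈ Finset.univ.erase a, x (w i) := by
      rw [← Finset.mul_prod_erase _ _ (Finset.mem_univ a), if_pos rfl, one_mul]
      exact Finset.prod_congr rfl fun i hi => if_neg (Finset.ne_of_mem_erase hi)
    rw [hprod]
    have hiff : (∀ q, Function.Injective (fun i : {i // f i = q} => w i.1) ∧
        ∀ i : {i // f i = q}, i.1 = a → w i.1 = c) ↔
        w a = c ∧ ∀ j k : Fin d, j ≠ k → sameBlock π j k → col (w j) ≠ col (w k) := by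
      constructor
      · intro h
        refine ⟨(h (f a)).2 ⟨a, rfl⟩ rfl, fun j k hjk hb hw => hjk ?_⟩
        have hk : f j = f k := Subtype.ext ((sameBlock_iff_part π j k).1 hb)
        exact congrArg Subtype.val (@(h (f k)).1 ⟨j, hk⟩ ⟨k, rfl⟩ (hcol hw))
      · rintro ⟨h1, h2⟩ q
        refine ⟨fun i j hij => ?_, fun i hi => by rw [hi, h1]⟩
        by_contra hne
        refine h2 i.1 j.1 (fun e => hne (Subtype.ext e)) ?_ (congrArg col hij)
        rw [sameBlock_iff_part]
        exact congrArg Subtype.val (i.2.trans j.2.symm)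
    simp only [Finset.mem_univ, true_imp_iff]
    rw [if_congr hiff rfl rfl, ite_and]
    refine if_congr Iff.rfl ?_ rfl
    unfold eSP
    split_ifs <;> simp
  rw [markedSum_apply, Finset.sum_congr rfl fun w _ => h1 w, sum_prod_fibers f F]
  have hcard : ∀ q : {B // B ∈ π.parts}, Fintype.card {i // f i = q} = q.1.card := by
    intro q
    rw [Fintype.card_subtype]
    congr 1
    ext i
    simp [hf]
  let g : Finset (Fin d) → R := fun B =>
    if B = blockOf π a then
      ((blockOf π a).card - 1).factorial * esum x (Finset.univ.erase c) ((blockOf π a).card - 1)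
    else B.card.factorial * esum x Finset.univ B.card
  have hg : ∀ q : {B // B ∈ π.parts}, ∑ v, F q v = g q.1 := by
    intro q
    simp only [g]
    split_ifs with hq
    · have ha : f a = q := Subtype.ext (by rw [hq, blockOf_eq_part])
      have hpos : 0 < q.1.card := Finset.card_pos.2 ⟨a, (hf a q).1 ha⟩
      rw [← hq, ← sum_marked_block x (⟨a, ha⟩ : {i // f i = q}) c (m := q.1.card - 1)
        (by rw [hcard]; omega)]
      refine Finset.sum_congr rfl fun v _ => ?_
      refine if_congr (and_congr_right fun _ => ?_) (Finset.prod_congr rfl fun i _ => ?_) rfl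
      · constructor
        · exact fun h => h ⟨a, ha⟩ rfl
        · intro h i hi
          rw [← h]
          congr 1
          exact Subtype.ext hi
      · exact if_congr (Subtype.ext_iff (a2 := ⟨a, ha⟩)).symm rfl rfl
    · have ha : ∀ i : {i // f i = q}, i.1 ≠ a := by
        intro i hi
        exact hq (by rw [blockOf_eq_part, ← hi]; exact congrArg Subtype.val i.2.symm)
      rw [← sum_injWeight x _ (hcard q)]
      refine Finset.sum_congr rfl fun v _ => ?_
      refine if_congr (and_congr_right fun _ => ?_) (Finset.prod_congr rfl fun i _ => ?_) rfl
      · simp [ha]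
      · rw [if_neg (ha i)]
  rw [Finset.prod_congr rfl fun q _ => hg q, Finset.prod_coe_sort π.parts g]
  have hb : blockOf π a ∈ π.parts := by
    rw [blockOf_eq_part]
    exact π.part_mem.2 (Finset.mem_univ a)
  rw [← Finset.mul_prod_erase _ _ hb, mul_comm]
  unfold typeGF ptype
  congr 1
  · rw [Multiset.map_map]
    exact Finset.prod_congr rfl fun B hB => if_neg (Finset.ne_of_mem_erase hB)
  · exact if_pos rfl

theorem markedSum_eq_zero_of_mem_Ksub {d : ℕ} {A R : Type*} [Fintype A] [CommRing R] [Algebra ℚ R]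
    {col : A → ℕ+} (hcol : Function.Injective col) (x : A → R) {a : Fin d} (c : A) {f : Md d}
    (hf : f ∈ Ksub a) : markedSum col x a c f = 0 := by
  unfold Ksub at hf
  induction hf using Submodule.span_induction with
  | mem f h =>
    obtain ⟨π₁, π₂, h, rfl⟩ := h
    rw [map_sub, markedSum_eSP hcol, markedSum_eSP hcol, h, sub_self]
  | zero => simp
  | add f g _ _ hf hg => rw [map_add, hf, hg, add_zero]
  | smul r f _ hf => rw [map_smul, hf, smul_zero]

theorem exists_finpartition_card {V : Type*} [DecidableEq V] (l : Multiset ℕ) (hl : ∀ j ∈ l, j ≠ 0) (S : Finset V)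
    (hS : l.sum = S.card) : ∃ P : Finpartition S, P.parts.val.map Finset.card = l := by
  induction l using Multiset.induction_on generalizing S with
  | empty =>
    rw [Multiset.sum_zero] at hS
    obtain rfl := Finset.card_eq_zero.1 hS.symm
    exact ⟨Finpartition.empty _, rfl⟩
  | cons j l ih =>
    rw [Multiset.sum_cons] at hS
    obtain ⟨B, hBS, hB⟩ := Finset.exists_subset_card_eq (show j ≤ S.card by omega)
    obtain ⟨P, hP⟩ := ih (fun i hi => hl i (Multiset.mem_cons_of_mem hi)) (S \ B) (by
      rw [Finset.card_sdiff_of_subset hBS]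
      omega)
    have hB0 : B ≠ ⊥ := by
      rintro rfl
      exact hl j (Multiset.mem_cons_self j l) (by simpa using hB.symm)
    refine ⟨P.extend hB0 Finset.sdiff_disjoint (Finset.sdiff_union_of_subset hBS), ?_⟩
    rw [Finpartition.extend_parts, Finset.insert_val_of_notMem, Multiset.map_cons, hP, hB]
    intro h
    obtain ⟨i, hi⟩ := Finset.nonempty_of_ne_empty hB0
    exact (Finset.mem_sdiff.1 (P.le h hi)).2 hi

theorem exists_eSP_markedSum {d : ℕ} (a : Fin d) (l : Multiset ℕ) (s : ℕ) (h : l.sum + (s + 1) = d) :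
    ∃ π : SetPtn d, ∀ (A R : Type) [Fintype A] [CommRing R] [Algebra ℚ R] (col : A → ℕ+) (x : A → R)
      (c : A), Function.Injective col → markedSum col x a c (eSP π) = typeGF x c l s := by
  obtain ⟨B, haB, -, hB⟩ := Finset.exists_subsuperset_card_eq
    (Finset.singleton_subset_iff.2 (Finset.mem_univ a)) (n := s + 1) (by simp)
    (by rw [Finset.card_univ, Fintype.card_fin]; omega)
  rw [Finset.singleton_subset_iff] at haB
  have hsum : (l.filter (· ≠ 0)).sum = l.sum := by
    conv_rhs => rw [← Multiset.filter_add_not (· ≠ 0) l, Multiset.sum_add]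
    rw [Multiset.sum_eq_zero (s := l.filter fun j => ¬ j ≠ 0), add_zero]
    intro j hj
    simpa using (Multiset.mem_filter.1 hj).2
  obtain ⟨P, hP⟩ := exists_finpartition_card (l.filter (· ≠ 0))
    (fun j hj => (Multiset.mem_filter.1 hj).2) (Finset.univ \ B) (by
      rw [hsum, Finset.card_sdiff_of_subset (Finset.subset_univ B), hB, Finset.card_univ,
        Fintype.card_fin]
      omega)
  have hB0 : B ≠ ⊥ := Finset.ne_empty_of_mem haB
  have hBP : B ∉ P.parts := fun h => (Finset.mem_sdiff.1 (P.le h haB)).2 haB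
  let π : SetPtn d := P.extend hB0 Finset.sdiff_disjoint
    (Finset.sdiff_union_of_subset (Finset.subset_univ B))
  have hblock : blockOf π a = B := by
    rw [blockOf_eq_part]
    exact π.part_eq_of_mem (Finset.mem_insert_self B P.parts) haB
  have htype : ptype π a = (l.filter (· ≠ 0), s + 1) := by
    unfold ptype
    rw [hblock, hB]
    congr 1
    change ((insert B P.parts).erase B).val.map Finset.card = _
    rw [Finset.erase_insert hBP, hP]
  refine ⟨π, fun A R _ _ _ col x c hcol => ?_⟩
  rw [markedSum_eSP hcol, htype]
  unfold typeGF
  congr 1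
  conv_rhs => rw [← Multiset.filter_add_not (· ≠ 0) l, Multiset.map_add, Multiset.prod_add]
  rw [Multiset.prod_eq_one (s := Multiset.map _ (l.filter fun j => ¬ j ≠ 0)), mul_one]
  intro r hr
  obtain ⟨j, hj, rfl⟩ := Multiset.mem_map.1 hr
  obtain rfl : j = 0 := by simpa using (Multiset.mem_filter.1 hj).2
  simp [esum_zero]

theorem sum_avoid_two {ι A R : Type*} [Fintype ι] [DecidableEq ι] [Fintype A] [CommRing R]
    (x : A → R) {m j : ℕ} (hm : Fintype.card ι = m + 2) {S K : Finset ι} (hSK : S ⊆ K)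
    (hK : K.card = j + 1) (c c' : A) :
    (∑ u : ι → A, if Function.Injective u ∧ (∀ i ∈ K, u i ≠ c) ∧ ∀ i, i ∉ S → u i ≠ c' then
      ∏ i, x (u i) else 0) =
      ((m + 2).factorial * esum x (Finset.univ.erase c') (m + 2) - (j + 1 : ℕ) *
        (if c ∈ Finset.univ.erase c' then x c * ((m + 1).factorial *
          esum x ((Finset.univ.erase c').erase c) (m + 1)) else 0)) +
      S.card * (if c ∈ Finset.univ.erase c' then
        x c' * ((m + 1).factorial * esum x (Finset.univ.erase c') (m + 1) -
          j * (x c * (m.factorial * esum x ((Finset.univ.erase c').erase c) m))) else 0) := by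
  have h1 : ∀ u : ι → A,
      (if Function.Injective u ∧ (∀ i ∈ K, u i ≠ c) ∧ ∀ i, i ∉ S → u i ≠ c' then
        ∏ i, x (u i) else 0) =
      (if ∀ i ∈ K, u i ≠ c then injWeight x (Finset.univ.erase c') u else 0) +
        ∑ s ∈ S, if u s = c' then
          (if ∀ i ∈ K, u i ≠ c then injWeight x Finset.univ u else 0) else 0 := by
    intro u
    by_cases hu : Function.Injective u
    swap
    · simp [hu, injWeight]
    by_cases hc : ∀ i ∈ K, u i ≠ c
    swap
    · simp [hc]
    simp only [injWeight, hu, true_and, if_pos hc, Finset.mem_univ, implies_true, if_true,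
      Finset.mem_erase, and_true]
    simp only [and_iff_right hc]
    by_cases hS : ∃ s ∈ S, u s = c'
    · obtain ⟨s, hs, hsc⟩ := hS
      rw [if_pos, if_neg, zero_add, Finset.sum_eq_single s, if_pos hsc]
      · exact fun t _ hts => if_neg fun ht => hts (hu (ht.trans hsc.symm))
      · exact fun h => absurd hs h
      · exact fun h => h s hsc
      · exact fun i hi hic => hi (hu (hsc.trans hic.symm) ▸ hs)
    · push Not at hS
      rw [Finset.sum_eq_zero fun s hs => if_neg (hS s hs), add_zero]
      refine if_congr ⟨fun h i => ?_, fun h i _ => h i⟩ rfl rfl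
      by_cases hi : i ∈ S
      · exact hS i hi
      · exact h i hi
  rw [Finset.sum_congr rfl fun u _ => h1 u, Finset.sum_add_distrib, Finset.sum_comm,
    sum_injWeight_avoid x _ (m := m + 1) hm K c, hK]
  congr 1
  rw [← nsmul_eq_mul, ← Finset.sum_const]
  refine Finset.sum_congr rfl fun s hs => ?_
  rw [sum_ite_apply_eq]
  have h2 : ∀ v : {i // i ≠ s} → A, (Equiv.funSplitAt s A).symm (c', v) s = c' := fun v => by simp
  have h3 : ∀ (v : {i // i ≠ s} → A) (i : {i // i ≠ s}),
      (Equiv.funSplitAt s A).symm (c', v) i = v i := by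
    intro v i
    simp [i.2]
  split_ifs with hcc
  · have hcc' : c' ≠ c := (Finset.ne_of_mem_erase hcc).symm
    have hcard : Fintype.card {i // i ≠ s} = m + 1 := by
      rw [Fintype.card_subtype_compl, Fintype.card_subtype_eq, hm]
      rfl
    have hK' : (K.subtype (· ≠ s)).card = j := by
      rw [Finset.card_subtype, Finset.filter_ne', Finset.card_erase_of_mem (hSK hs), hK]
      rfl
    have h4 := sum_injWeight_avoid x (Finset.univ.erase c') hcard (K.subtype (· ≠ s)) c
    rw [hK', if_pos hcc] at h4
    rw [← h4, Finset.mul_sum]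
    refine Finset.sum_congr rfl fun v _ => ?_
    rw [injWeight_split x _ _ s, h2, if_pos (Finset.mem_univ _), mul_ite, mul_zero]
    refine if_congr ?_ ?_ rfl
    · constructor
      · intro h i hi
        rw [← h3 v i]
        exact h i (Finset.mem_subtype.1 hi)
      · intro h i hi
        by_cases his : i = s
        · rwa [his, h2]
        · rw [h3 v ⟨i, his⟩]
          exact h ⟨i, his⟩ (Finset.mem_subtype.2 hi)
    · congr 2
      funext i
      exact h3 v i
  · obtain rfl : c = c' := by simpa using hcc
    refine Finset.sum_eq_zero fun v _ => if_neg fun h => ?_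
    exact h s (hSK hs) (h2 v)

theorem proper_cons_snoc_iff {N : ℕ} {A : Type*} (G : SimpleGraph (Fin (N + 2))) (c c' : A)
    (u : Fin N → A) :
    (∀ j k : Fin (N + 2), G.Adj j k →
        (Fin.cons c (Fin.snoc u c' : Fin (N + 1) → A) : Fin (N + 2) → A) j ≠
          (Fin.cons c (Fin.snoc u c' : Fin (N + 1) → A) : Fin (N + 2) → A) k) ↔
      (∀ i j : Fin N, G.Adj i.castSucc.succ j.castSucc.succ → u i ≠ u j) ∧
      (∀ i : Fin N, G.Adj 0 i.castSucc.succ → u i ≠ c) ∧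
      (∀ i : Fin N, G.Adj (Fin.last (N + 1)) i.castSucc.succ → u i ≠ c') ∧
      (G.Adj 0 (Fin.last (N + 1)) → c ≠ c') := by
  rw [← Fin.succ_last]
  constructor
  · intro h
    refine ⟨fun i j hij => ?_, fun i hi => ?_, fun i hi => ?_, fun hl => ?_⟩
    · simpa using h _ _ hij
    · simpa using h _ _ hi.symm
    · simpa using h _ _ hi.symm
    · simpa using h _ _ hl
  · rintro ⟨h1, h2, h3, h4⟩ j k hjk
    induction j using Fin.cases with
    | zero =>
      induction k using Fin.cases with
      | zero => exact absurd hjk (G.loopless.irrefl _)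
      | succ k =>
        induction k using Fin.lastCases with
        | last => simpa using h4 hjk
        | cast k => simpa using (h2 k hjk).symm
    | succ j =>
      induction j using Fin.lastCases with
      | last =>
        induction k using Fin.cases with
        | zero => simpa using (h4 hjk.symm).symm
        | succ k =>
          induction k using Fin.lastCases with
          | last => exact absurd hjk (G.loopless.irrefl _)
          | cast k => simpa using (h3 k hjk).symm
      | cast j =>
        induction k using Fin.cases with
        | zero => simpa using h2 j hjk.symm
        | succ k =>
          induction k using Fin.lastCases with
          | last => simpa using h3 j hjk.symm
          | cast k => simpa using h1 j k hjk

/-- The transfer weight of appending `H` at a vertex coloured `c`, the last vertex being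
coloured `c'`. -/
def transfer {N : ℕ} {A R : Type*} [Fintype A] [CommRing R] [Algebra ℚ R] (col : A → ℕ+) (x : A → R)
    (H : SimpleGraph (Fin (N + 2))) (c c' : A) : R :=
  markedSum col x (Fin.last N) c' fun w => YG H (Fin.cons (col c) w : Fin (N + 2) → ℕ+)

theorem transfer_eq_sum {N : ℕ} {A R : Type*} [Fintype A] [CommRing R] [Algebra ℚ R]
    {col : A → ℕ+} (hcol : Function.Injective col) (x : A → R) (H : SimpleGraph (Fin (N + 2)))
    (c c' : A) :
    transfer col x H c c' = ∑ u : Fin N → A,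
      if ∀ j k : Fin (N + 2), H.Adj j k →
        (Fin.cons c (Fin.snoc u c' : Fin (N + 1) → A) : Fin (N + 2) → A) j ≠
          (Fin.cons c (Fin.snoc u c' : Fin (N + 1) → A) : Fin (N + 2) → A) k
      then ∏ i, x (u i) else 0 := by
  unfold transfer
  rw [markedSum_apply, ← (Fin.snocEquiv fun _ => A).sum_comp, Fintype.sum_prod_type,
    Finset.sum_eq_single c']
  · refine Finset.sum_congr rfl fun u _ => ?_
    have hs : (Fin.snocEquiv fun _ : Fin (N + 1) => A) (c', u) = Fin.snoc u c' := rfl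
    rw [hs, if_pos (Fin.snoc_last _ _)]
    have hprod : ∏ i ∈ Finset.univ.erase (Fin.last N), x ((Fin.snoc u c' : Fin (N + 1) → A) i) =
        ∏ i, x (u i) := by
      rw [Fin.univ_castSuccEmb, Finset.cons_eq_insert, Finset.erase_insert (by simp),
        Finset.prod_map]
      simp
    rw [hprod]
    unfold YG
    have hW : ∀ j : Fin (N + 2), (Fin.cons (col c)
        (fun i => col ((Fin.snoc u c' : Fin (N + 1) → A) i)) : Fin (N + 2) → ℕ+) j =
        col ((Fin.cons c (Fin.snoc u c' : Fin (N + 1) → A) : Fin (N + 2) → A) j) := by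
      intro j
      induction j using Fin.cases <;> simp
    simp only [hW, hcol.ne_iff]
    split_ifs <;> simp
  · intro c₁ _ hc₁
    refine Finset.sum_eq_zero fun u _ => if_neg ?_
    have hs : (Fin.snocEquiv fun _ : Fin (N + 1) => A) (c₁, u) = Fin.snoc u c₁ := rfl
    rw [hs, Fin.snoc_last]
    exact hc₁
  · simp

/-- The common shape of the transfer weights of snowy twin peaks graphs and their reverses. -/
def stpWeight {A R : Type*} [Fintype A] [CommRing R] (x : A → R) (m j κ : ℕ) (c c' : A) : R :=
  ((m + 2).factorial * esum x (Finset.univ.erase c') (m + 2) - (j + 1 : ℕ) *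
    (if c ∈ Finset.univ.erase c' then x c * ((m + 1).factorial *
      esum x ((Finset.univ.erase c').erase c) (m + 1)) else 0)) +
  κ * (if c ∈ Finset.univ.erase c' then
    x c' * ((m + 1).factorial * esum x (Finset.univ.erase c') (m + 1) -
      j * (x c * (m.factorial * esum x ((Finset.univ.erase c').erase c) m))) else 0)

theorem transfer_STP {A R : Type*} [Fintype A] [CommRing R] [Algebra ℚ R]
    {col : A → ℕ+} (hcol : Function.Injective col) (x : A → R) {m j : ℕ} (hj : j ≤ m) (c c' : A) :
    transfer (N := m + 2) col x (STPgraph (m + 3) (j + 1)) c c' = stpWeight x m j 1 c c' := by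
  have h1 : ∀ u : Fin (m + 2) → A, (∀ a b : Fin (m + 4), (STPgraph (m + 3) (j + 1)).Adj a b →
      (Fin.cons c (Fin.snoc u c' : Fin (m + 3) → A) : Fin (m + 4) → A) a ≠
        (Fin.cons c (Fin.snoc u c' : Fin (m + 3) → A) : Fin (m + 4) → A) b) ↔
      Function.Injective u ∧ (∀ i ∈ Finset.univ.filter fun i : Fin (m + 2) => (i : ℕ) < j + 1, u i ≠ c) ∧
        ∀ i, i ∉ Finset.univ.filter (fun i : Fin (m + 2) => (i : ℕ) < 1) → u i ≠ c' := by
    intro u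
    rw [proper_cons_snoc_iff]
    have e1 : ∀ a b : Fin (m + 2),
        (STPgraph (m + 3) (j + 1)).Adj a.castSucc.succ b.castSucc.succ ↔ a ≠ b := by
      rintro ⟨a, ha⟩ ⟨b, hb⟩
      simp only [STPgraph, SimpleGraph.fromRel_adj, ne_eq, Fin.ext_iff, Fin.val_succ,
        Fin.val_castSucc]
      grind
    have e2 : ∀ b : Fin (m + 2),
        (STPgraph (m + 3) (j + 1)).Adj 0 b.castSucc.succ ↔ (b : ℕ) < j + 1 := by
      rintro ⟨b, hb⟩
      simp only [STPgraph, SimpleGraph.fromRel_adj, ne_eq, Fin.ext_iff, Fin.val_succ,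
        Fin.val_castSucc, Fin.val_zero]
      grind
    have e3 : ∀ b : Fin (m + 2),
        (STPgraph (m + 3) (j + 1)).Adj (Fin.last (m + 3)) b.castSucc.succ ↔ ¬ (b : ℕ) < 1 := by
      rintro ⟨b, hb⟩
      simp only [STPgraph, SimpleGraph.fromRel_adj, ne_eq, Fin.ext_iff, Fin.val_succ,
        Fin.val_castSucc, Fin.val_last]
      grind
    have e4 : ¬ (STPgraph (m + 3) (j + 1)).Adj 0 (Fin.last (m + 3)) := by
      simp only [STPgraph, SimpleGraph.fromRel_adj, ne_eq, Fin.ext_iff, Fin.val_last, Fin.val_zero]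
      grind
    simp only [e1, e2, e3, e4, Finset.mem_filter, Finset.mem_univ, true_and, false_imp_iff,
      and_true]
    refine and_congr ?_ Iff.rfl
    exact ⟨fun h a b hab => by_contra fun hne => h a b hne hab, fun h a b hab => h.ne hab⟩
  have h2 := sum_avoid_two x (m := m) (j := j)
    (S := Finset.univ.filter fun i : Fin (m + 2) => (i : ℕ) < 1)
    (K := Finset.univ.filter fun i : Fin (m + 2) => (i : ℕ) < j + 1) (by simp)
    (fun i hi => by
      simp only [Finset.mem_filter, Finset.mem_univ, true_and] at hi ⊢
      omega)
    (by
      rw [Fin.card_filter_val_lt]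
      omega) c c'
  rw [Fin.card_filter_val_lt, min_eq_right (by omega)] at h2
  rw [transfer_eq_sum hcol]
  refine Eq.trans (Finset.sum_congr rfl fun u _ => ?_) h2
  congr 1
  exact propext (h1 u)

theorem transfer_revG_STP {A R : Type*} [Fintype A] [CommRing R] [Algebra ℚ R]
    {col : A → ℕ+} (hcol : Function.Injective col) (x : A → R) {m j : ℕ} (hj : j ≤ m) (c c' : A) :
    transfer (N := m + 2) col x (revG (STPgraph (m + 3) (j + 1))) c c' =
      stpWeight x m m (m + 1 - j) c c' := by
  have h1 : ∀ u : Fin (m + 2) → A, (∀ a b : Fin (m + 4), (revG (STPgraph (m + 3) (j + 1))).Adj a b →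
      (Fin.cons c (Fin.snoc u c' : Fin (m + 3) → A) : Fin (m + 4) → A) a ≠
        (Fin.cons c (Fin.snoc u c' : Fin (m + 3) → A) : Fin (m + 4) → A) b) ↔
      Function.Injective u ∧ (∀ i ∈ Finset.univ.filter fun i : Fin (m + 2) => (i : ℕ) < m + 1, u i ≠ c) ∧
        ∀ i, i ∉ Finset.univ.filter (fun i : Fin (m + 2) => (i : ℕ) < m + 1 - j) → u i ≠ c' := by
    intro u
    rw [proper_cons_snoc_iff]
    have e1 : ∀ a b : Fin (m + 2),
        (revG (STPgraph (m + 3) (j + 1))).Adj a.castSucc.succ b.castSucc.succ ↔ a ≠ b := by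
      intro a b
      simp only [revG, SimpleGraph.comap_adj, STPgraph, SimpleGraph.fromRel_adj, ne_eq, Fin.ext_iff,
        Fin.val_succ, Fin.val_castSucc]
      split_ifs <;> omega
    have e2 : ∀ b : Fin (m + 2),
        (revG (STPgraph (m + 3) (j + 1))).Adj 0 b.castSucc.succ ↔ (b : ℕ) < m + 1 := by
      intro b
      simp only [revG, SimpleGraph.comap_adj, STPgraph, SimpleGraph.fromRel_adj, ne_eq, Fin.ext_iff,
        Fin.val_succ, Fin.val_castSucc, Fin.val_zero]
      split_ifs <;> omega
    have e3 : ∀ b : Fin (m + 2), (revG (STPgraph (m + 3) (j + 1))).Adj (Fin.last (m + 3))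
        b.castSucc.succ ↔ ¬ (b : ℕ) < m + 1 - j := by
      intro b
      simp only [revG, SimpleGraph.comap_adj, STPgraph, SimpleGraph.fromRel_adj, ne_eq, Fin.ext_iff,
        Fin.val_succ, Fin.val_castSucc, Fin.val_last]
      split_ifs <;> omega
    have e4 : ¬ (revG (STPgraph (m + 3) (j + 1))).Adj 0 (Fin.last (m + 3)) := by
      simp only [revG, SimpleGraph.comap_adj, STPgraph, SimpleGraph.fromRel_adj, ne_eq, Fin.ext_iff,
        Fin.val_last, Fin.val_zero]
      split_ifs <;> omega
    simp only [e1, e2, e3, e4, Finset.mem_filter, Finset.mem_univ, true_and, false_imp_iff,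
      and_true]
    refine and_congr ?_ Iff.rfl
    exact ⟨fun h a b hab => by_contra fun hne => h a b hne hab, fun h a b hab => h.ne hab⟩
  have h2 := sum_avoid_two x (m := m) (j := m)
    (S := Finset.univ.filter fun i : Fin (m + 2) => (i : ℕ) < m + 1 - j)
    (K := Finset.univ.filter fun i : Fin (m + 2) => (i : ℕ) < m + 1) (by simp)
    (fun i hi => by
      simp only [Finset.mem_filter, Finset.mem_univ, true_and] at hi ⊢
      omega)
    (by
      rw [Fin.card_filter_val_lt]
      omega) c c'
  rw [Fin.card_filter_val_lt, min_eq_right (by omega)] at h2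
  rw [transfer_eq_sum hcol]
  refine Eq.trans (Finset.sum_congr rfl fun u _ => ?_) h2
  congr 1
  exact propext (h1 u)

theorem YG_concatG {p n : ℕ} (hp : 0 < p) (G : SimpleGraph (Fin p)) (H : SimpleGraph (Fin (n + 1)))
    (u : Fin p → ℕ+) (v : Fin n → ℕ+) :
    YG (d := p + n) (concatG G H) (Fin.append u v) =
      YG G u * YG H (Fin.cons (u ⟨p - 1, by omega⟩) v : Fin (n + 1) → ℕ+) := by
  have hL : ∀ i : Fin p, Fin.append u v (Fin.castAdd n i) = u i := Fin.append_left u v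
  have hR : ∀ (i : Fin (n + 1)) (h : (i : ℕ) + (p - 1) < p + n), Fin.append u v ⟨i + (p - 1), h⟩ =
      (Fin.cons (u ⟨p - 1, by omega⟩) v : Fin (n + 1) → ℕ+) i := by
    intro i h
    induction i using Fin.cases with
    | zero =>
      rw [Fin.cons_zero, ← hL]
      congr 1
      ext
      simp
    | succ i =>
      rw [Fin.cons_succ, ← Fin.append_right u v]
      congr 1
      ext
      simp
      omega
  have key : (∀ a b : Fin (p + n), (concatG G H).Adj a b → Fin.append u v a ≠ Fin.append u v b) ↔
      (∀ i j, G.Adj i j → u i ≠ u j) ∧ ∀ i j, H.Adj i j →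
        (Fin.cons (u ⟨p - 1, by omega⟩) v : Fin (n + 1) → ℕ+) i ≠
          (Fin.cons (u ⟨p - 1, by omega⟩) v : Fin (n + 1) → ℕ+) j := by
    constructor
    · intro h
      refine ⟨fun i j hij => ?_, fun i j hij => ?_⟩
      · rw [← hL, ← hL]
        refine h _ _ ((SimpleGraph.fromRel_adj _ _ _).2 ⟨?_, Or.inl (Or.inl ⟨i, j, hij, rfl, rfl⟩)⟩)
        exact fun e => hij.ne (Fin.castAdd_injective p n e)
      · have hi := i.isLt
        have hj := j.isLt
        rw [← hR i (by omega), ← hR j (by omega)]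
        refine h _ _ ((SimpleGraph.fromRel_adj _ _ _).2 ⟨?_, Or.inl (Or.inr ⟨i, j, hij, rfl, rfl⟩)⟩)
        intro e
        have e' := congrArg Fin.val e
        simp only at e'
        exact hij.ne (Fin.ext (by omega))
    · rintro ⟨hG, hH⟩
      have hrel : ∀ a b : Fin (p + n),
          ((∃ i j : Fin p, G.Adj i j ∧ (a : ℕ) = (i : ℕ) ∧ (b : ℕ) = (j : ℕ)) ∨
          (∃ i j : Fin (n + 1), H.Adj i j ∧ (a : ℕ) = (i : ℕ) + (p - 1) ∧
            (b : ℕ) = (j : ℕ) + (p - 1))) → Fin.append u v a ≠ Fin.append u v b := by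
        rintro a b (⟨i, j, hij, ha, hb⟩ | ⟨i, j, hij, ha, hb⟩)
        · obtain rfl : a = Fin.castAdd n i := Fin.ext ha
          obtain rfl : b = Fin.castAdd n j := Fin.ext hb
          rw [hL, hL]
          exact hG i j hij
        · have ha' : a = ⟨i + (p - 1), ha ▸ a.isLt⟩ := Fin.ext ha
          have hb' : b = ⟨j + (p - 1), hb ▸ b.isLt⟩ := Fin.ext hb
          rw [ha', hb', hR, hR]
          exact hH i j hij
      intro a b hab
      obtain ⟨-, h | h⟩ := (SimpleGraph.fromRel_adj _ _ _).1 hab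
      · exact hrel a b h
      · exact (hrel b a h).symm
  unfold YG
  rw [if_congr key rfl rfl, ite_and]
  split_ifs <;> simp

theorem markedSum_concatG {p N : ℕ} (hp : 0 < p) {A R : Type*} [Fintype A] [CommRing R] [Algebra ℚ R]
    (col : A → ℕ+) (x : A → R) (G : SimpleGraph (Fin p)) (H : SimpleGraph (Fin (N + 2))) (c' : A) :
    markedSum (d := p + (N + 1)) col x (Fin.natAdd p (Fin.last N)) c' (YG (concatG G H)) =
      ∑ c, markedSum col x ⟨p - 1, by omega⟩ c (YG G) * (x c * transfer col x H c c') := by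
  have h1 : ∀ (u : Fin p → A) (v : Fin (N + 1) → A),
      (if (Fin.append u v) (Fin.natAdd p (Fin.last N)) = c' then
        YG (d := p + (N + 1)) (concatG G H) (fun i => col (Fin.append u v i)) •
          ∏ i ∈ Finset.univ.erase (Fin.natAdd p (Fin.last N)), x (Fin.append u v i) else 0) =
      ∑ c, (if u ⟨p - 1, by omega⟩ = c then YG G (fun i => col (u i)) •
          ∏ i ∈ Finset.univ.erase ⟨p - 1, by omega⟩, x (u i) else 0) *
        (x c * if v (Fin.last N) = c' then
          YG H (Fin.cons (col c) (fun i => col (v i)) : Fin (N + 2) → ℕ+) •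
            ∏ i ∈ Finset.univ.erase (Fin.last N), x (v i) else 0) := by
    intro u v
    have hlast : Fin.append u v (Fin.natAdd p (Fin.last N)) = v (Fin.last N) := Fin.append_right u v (Fin.last N)
    have hcol : (fun i => col (Fin.append u v i)) = Fin.append (fun i => col (u i)) fun i => col (v i) := by
      funext i
      induction i using Fin.addCases <;> simp
    have hprod : ∏ i ∈ Finset.univ.erase (Fin.natAdd p (Fin.last N)), x (Fin.append u v i) =
        (∏ i, x (u i)) * ∏ i ∈ Finset.univ.erase (Fin.last N), x (v i) := by
      have hL : ∀ i, Fin.append u v (Fin.castAdd (N + 1) i) = u i := Fin.append_left u v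
      have hR : ∀ i, Fin.append u v (Fin.natAdd p i) = v i := Fin.append_right u v
      have e1 : ∏ i ∈ Finset.univ.erase (Fin.natAdd p (Fin.last N)), x (Fin.append u v i) =
          ∏ i : Fin (p + (N + 1)), if i = Fin.natAdd p (Fin.last N) then 1 else x (Fin.append u v i) := by
        rw [← Finset.mul_prod_erase _ _ (Finset.mem_univ (Fin.natAdd p (Fin.last N))), if_pos rfl, one_mul]
        exact Finset.prod_congr rfl fun i hi => (if_neg (Finset.ne_of_mem_erase hi)).symm
      rw [e1, Fin.prod_univ_add]
      congr 1
      · refine Finset.prod_congr rfl fun i _ => ?_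
        rw [hL, if_neg]
        intro h
        have h' := congrArg Fin.val h
        have := i.isLt
        simp at h'
        omega
      · rw [← Finset.mul_prod_erase _ _ (Finset.mem_univ (Fin.last N)),
          if_pos rfl, one_mul]
        refine Finset.prod_congr rfl fun i hi => ?_
        rw [hR, if_neg]
        intro h
        refine Finset.ne_of_mem_erase hi (Fin.ext ?_)
        have h' := congrArg Fin.val h
        simp at h'
        exact h'
    simp only [ite_mul, zero_mul]
    rw [Finset.sum_ite_eq, if_pos (Finset.mem_univ _), hlast, hcol, YG_concatG hp, hprod,
      ← Finset.mul_prod_erase Finset.univ (fun i => x (u i)) (Finset.mem_univ ⟨p - 1, by omega⟩)]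
    split_ifs
    · simp only [Algebra.smul_def, map_mul]
      ring
    · simp
  rw [markedSum_apply, ← (Fin.appendEquiv p (N + 1)).sum_comp, Fintype.sum_prod_type]
  refine (Finset.sum_congr rfl fun u _ => Finset.sum_congr rfl fun v _ => h1 u v).trans ?_
  rw [Finset.sum_congr rfl fun u _ => Finset.sum_comm, Finset.sum_comm]
  refine Finset.sum_congr rfl fun c _ => ?_
  rw [transfer, markedSum_apply, markedSum_apply, Finset.mul_sum, Finset.sum_mul_sum]

theorem mul_shift_eq_sum {S : Type*} [CommRing S] {e E : ℕ → S} {y : S} (h0 : E 0 = e 0)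
    (hE : ∀ j, E (j + 1) = e (j + 1) + y * e j) (b s : ℕ) :
    y * (e b * e s) = ∑ q ∈ Finset.range (b + 1),
      (E (b + 1 + s - q) * e q - E q * e (b + 1 + s - q)) := by
  induction b generalizing s with
  | zero =>
    simp only [zero_add, Finset.range_one, Finset.sum_singleton, Nat.sub_zero]
    rw [add_comm 1 s, hE, h0]
    ring
  | succ b ih =>
    have h1 := ih (s + 1)
    rw [Finset.sum_range_succ, show b + 1 + 1 + s = b + 1 + (s + 1) by ring, ← h1,
      show b + 1 + (s + 1) - (b + 1) = s + 1 by omega, hE, hE]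
    ring

theorem jSum_eq {S : Type*} [CommRing S] {e E : ℕ → S} {y : S} (h0 : E 0 = e 0)
    (hE : ∀ j, E (j + 1) = e (j + 1) + y * e j) {J : ℕ → ℕ → S} (hJ0 : ∀ s, J 0 s = 0)
    (hJ : ∀ b s, J (b + 1) s = J b (s + 1) + (b + 1) * (E (b + 1) * e s)
      - (s + 1) * (E b * e (s + 1)) - y * (e b * e s)) (b s : ℕ) :
    J b s = b * (E b * e s) - ∑ q ∈ Finset.range b,
      (((s : S) - q) * (E q * e (b + s - q)) + ((b : S) - q) * (E (b + s - q) * e q)) := by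
  induction b generalizing s with
  | zero => simp [hJ0]
  | succ b ih =>
    have h1 : ∑ q ∈ Finset.range b, ((((s + 1 : ℕ) : S) - q) * (E q * e (b + (s + 1) - q)) +
        ((b : S) - q) * (E (b + (s + 1) - q) * e q)) =
        ∑ q ∈ Finset.range b, (((s : S) - q) * (E q * e (b + 1 + s - q)) +
        (((b + 1 : ℕ) : S) - q) * (E (b + 1 + s - q) * e q)) -
        ∑ q ∈ Finset.range b, (E (b + 1 + s - q) * e q - E q * e (b + 1 + s - q)) := by
      rw [← Finset.sum_sub_distrib]
      refine Finset.sum_congr rfl fun q _ => ?_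
      rw [show b + (s + 1) = b + 1 + s by ring]
      push_cast
      ring
    have h2 := mul_shift_eq_sum h0 hE b s
    rw [Finset.sum_range_succ] at h2
    rw [hJ, ih, h1, Finset.sum_range_succ, h2, show b + 1 + s - b = s + 1 by omega]
    push_cast
    ring

theorem natCast_mul_mem {S : Type*} [CommRing S] {C : AddSubmonoid S} {z : S} (hz : z ∈ C) (N : ℕ) :
    (N : S) * z ∈ C := by
  rw [← nsmul_eq_mul]
  exact C.nsmul_mem hz N

theorem linear_cancel_mem {S : Type*} [CommRing S] {C : AddSubmonoid S} {P : ℕ → S} (m b X U V : ℕ)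
    (hX : X = U + V) (hP : ∀ t ≤ b + m + 3, P t ∈ C) :
    ∑ q ∈ Finset.range (b + 1), (((m : S) + 1 - q) * X + U) * P q +
      ∑ q ∈ Finset.range (b + 1), ((q : S) * X + V) * P (m + 2 + q) ∈ C := by
  have hpos : ∀ q ≤ m + 1, q ≤ b + m + 3 → (((m : S) + 1 - q) * X + U) * P q ∈ C := by
    intro q hq hq'
    have := natCast_mul_mem (hP q hq') ((m + 1 - q) * X + U)
    rw [Nat.cast_add, Nat.cast_mul, Nat.cast_sub hq] at this
    simpa using this
  have hpos' : ∀ q ≤ b, ((q : S) * X + V) * P (m + 2 + q) ∈ C := by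
    intro q hq
    have := natCast_mul_mem (hP (m + 2 + q) (by omega)) (q * X + V)
    rw [Nat.cast_add, Nat.cast_mul] at this
    exact this
  rcases le_total b (m + 1) with hb | hb
  · refine C.add_mem (C.sum_mem fun q hq => ?_) (C.sum_mem fun q hq => ?_)
    · have := Finset.mem_range.1 hq
      exact hpos q (by omega) (by omega)
    · have := Finset.mem_range.1 hq
      exact hpos' q (by omega)
  · obtain ⟨g, rfl⟩ := Nat.exists_eq_add_of_le hb
    have hs1 : m + 1 + g + 1 = (m + 2) + g := by ring
    have hs2 : m + 1 + g + 1 = g + (m + 2) := by ring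
    have hcancel : ∑ q ∈ Finset.range g, (((m : S) + 1 - ((m + 2 + q : ℕ) : S)) * X + U) * P (m + 2 + q) +
        ∑ q ∈ Finset.range g, ((q : S) * X + V) * P (m + 2 + q) = 0 := by
      rw [← Finset.sum_add_distrib]
      refine Finset.sum_eq_zero fun q _ => ?_
      rw [hX]
      push_cast
      ring
    have : ∑ q ∈ Finset.range (m + 1 + g + 1), (((m : S) + 1 - q) * X + U) * P q +
        ∑ q ∈ Finset.range (m + 1 + g + 1), ((q : S) * X + V) * P (m + 2 + q) =
        ∑ q ∈ Finset.range (m + 2), (((m : S) + 1 - q) * X + U) * P q +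
        ∑ q ∈ Finset.range (m + 2), (((g + q : ℕ) : S) * X + V) * P (m + 2 + (g + q)) := by
      conv_lhs =>
        congr
        · rw [hs1, Finset.sum_range_add]
        · rw [hs2, Finset.sum_range_add]
      linear_combination hcancel
    rw [this]
    refine C.add_mem (C.sum_mem fun q hq => ?_) (C.sum_mem fun q hq => ?_)
    · have := Finset.mem_range.1 hq
      exact hpos q (by omega) (by omega)
    · have := Finset.mem_range.1 hq
      exact hpos' (g + q) (by omega)

theorem antisymm_cancel_mem {S : Type*} [CommRing S] [Algebra ℚ S] {C : AddSubmonoid S} {E : ℕ → S}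
    (m b : ℕ) (hR : ∀ t ≤ b + m + 3, E t * E (b + m + 3 - t) ∈ C) :
    ∑ q ∈ Finset.range b, ((m : S) + b + 1 - 2 * q) * (E (q + 1) * E (b + m + 3 - (q + 1))) ∈ C := by
  have hpos : ∀ q < b, 2 * q ≤ m + b + 1 →
      ((m : S) + b + 1 - 2 * q) * (E (q + 1) * E (b + m + 3 - (q + 1))) ∈ C := by
    intro q hq hq'
    have := natCast_mul_mem (hR (q + 1) (by omega)) (m + b + 1 - 2 * q)
    rw [Nat.cast_sub hq'] at this
    simpa using this
  rcases le_total b (m + 2) with hb | hb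
  · refine C.sum_mem fun q hq => ?_
    have := Finset.mem_range.1 hq
    exact hpos q (by omega) (by omega)
  · obtain ⟨g, rfl⟩ := Nat.exists_eq_add_of_le hb
    rw [Finset.sum_range_add]
    have hz : ∑ q ∈ Finset.range g, ((m : S) + ((m + 2 + g : ℕ) : S) + 1 - 2 * ((m + 2 + q : ℕ) : S)) *
        (E (m + 2 + q + 1) * E (m + 2 + g + m + 3 - (m + 2 + q + 1))) = 0 := by
      set T := ∑ q ∈ Finset.range g, ((m : S) + ((m + 2 + g : ℕ) : S) + 1 - 2 * ((m + 2 + q : ℕ) : S)) *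
        (E (m + 2 + q + 1) * E (m + 2 + g + m + 3 - (m + 2 + q + 1))) with hT
      have h2 : T + T = 0 := by
        conv_lhs =>
          congr
          · rw [hT, ← Finset.sum_range_reflect]
          · rw [hT]
        rw [← Finset.sum_add_distrib]
        refine Finset.sum_eq_zero fun q hq => ?_
        have hq := Finset.mem_range.1 hq
        obtain ⟨r, rfl⟩ := Nat.exists_eq_add_of_lt hq
        rw [show q + r + 1 - 1 - q = r by omega,
          show m + 2 + (q + r + 1) + m + 3 - (m + 2 + r + 1) = m + 2 + q + 1 by omega,
          show m + 2 + (q + r + 1) + m + 3 - (m + 2 + q + 1) = m + 2 + r + 1 by omega]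
        push_cast
        ring
      have h3 : T = (1 / 2 : ℚ) • (T + T) := by
        rw [← two_smul ℚ T, smul_smul]
        norm_num
      rw [h3, h2, smul_zero]
    rw [hz, add_zero]
    refine C.sum_mem fun q hq => ?_
    have := Finset.mem_range.1 hq
    exact hpos q (by omega) (by omega)

/-- The polynomial obtained by summing the transfer weight of a snowy twin peaks graph
against a block of size `b + 1`, up to the factor `m!`. -/
def peakPoly {S : Type*} [CommRing S] (e E : ℕ → S) (y : S) (J : ℕ → ℕ → S) (m b j κ : ℕ) : S :=
  (m + 2) * (m + 1) * (b + 1) * (E (b + 1) * e (m + 2)) - (j + 1) * (m + 1) * J (b + 1) (m + 2) +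
    κ * (y * ((m + 1) * (e (m + 1) * ((b + 1) * E (b + 1) - y * e b)) - j * J (b + 1) (m + 1)))

theorem peakPoly_mem {S : Type*} [CommRing S] [Algebra ℚ S] {e E : ℕ → S} {y : S} (h0 : E 0 = e 0)
    (hE : ∀ j, E (j + 1) = e (j + 1) + y * e j) {J : ℕ → ℕ → S} (hJ0 : ∀ s, J 0 s = 0)
    (hJ : ∀ b s, J (b + 1) s = J b (s + 1) + (b + 1) * (E (b + 1) * e s)
      - (s + 1) * (E b * e (s + 1)) - y * (e b * e s)) {C : AddSubmonoid S} {m b j κ : ℕ}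
    (hj : j ≤ m) (hκ : κ ≤ j + 1)
    (hP : ∀ t ≤ b + m + 3, E t * e (b + m + 3 - t) ∈ C)
    (hR : ∀ t ≤ b + m + 3, E t * E (b + m + 3 - t) ∈ C) :
    peakPoly e E y J m b j κ ∈ C := by
  obtain ⟨i, rfl⟩ := Nat.exists_eq_add_of_le hj
  obtain ⟨l, hl⟩ := Nat.exists_eq_add_of_le hκ
  have hlS : (j : S) + 1 = κ + l := by exact_mod_cast congrArg (Nat.cast (R := S)) hl
  set m := j + i with hm
  have hmS : (m : S) = j + i := by rw [hm]; push_cast; rfl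
  set P : ℕ → S := fun t => E t * e (b + m + 3 - t) with hPdef
  set R : ℕ → S := fun t => E t * E (b + m + 3 - t) with hRdef
  set s0 := ∑ q ∈ Finset.range (b + 1), P q with hs0
  set s1 := ∑ q ∈ Finset.range (b + 1), ((m : S) + 1 - q) * P q with hs1
  set t0 := ∑ q ∈ Finset.range (b + 1), P (m + 2 + q) with ht0
  set t1 := ∑ q ∈ Finset.range (b + 1), (q : S) * P (m + 2 + q) with ht1
  set r := ∑ q ∈ Finset.range b, ((m : S) + b + 1 - 2 * q) * R (q + 1) with hr
  have ht0' : ∑ q ∈ Finset.range (b + 1), E (b + m + 2 - q) * e (q + 1) = t0 := by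
    rw [ht0, ← Finset.sum_range_reflect]
    refine Finset.sum_congr rfl fun q hq => ?_
    have := Finset.mem_range.1 hq
    rw [hPdef]
    dsimp only
    congr 2 <;> omega
  have ht1' : ∑ q ∈ Finset.range (b + 1), ((b : S) - q) * (E (b + m + 2 - q) * e (q + 1)) = t1 := by
    rw [ht1, ← Finset.sum_range_reflect]
    refine Finset.sum_congr rfl fun q hq => ?_
    have := Finset.mem_range.1 hq
    rw [hPdef]
    dsimp only
    rw [show b + 1 - 1 - q = b - q by omega, Nat.cast_sub (by omega),
      show b + m + 2 - (b - q) = m + 2 + q by omega,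
      show b + m + 3 - (m + 2 + q) = b - q + 1 by omega, sub_sub_cancel]
  have hyP : ∀ q < b + m + 3, y * (E q * e (b + m + 2 - q)) = R q - P q := by
    intro q hq
    rw [hPdef, hRdef]
    dsimp only
    rw [show b + m + 3 - q = b + m + 2 - q + 1 by omega, hE (b + m + 2 - q)]
    ring
  have hyP' : ∀ q, y * (E (b + m + 2 - q) * e q) =
      R (q + 1) - E (b + m + 2 - q) * e (q + 1) := by
    intro q
    rw [hRdef]
    dsimp only
    rw [show b + m + 3 - (q + 1) = b + m + 2 - q by omega, hE q]
    ring
  have h1 : J (b + 1) (m + 2) = (b + 1) * P (b + 1) - (s1 + s0 + (b + 1) * P (b + m + 3) + t1) := by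
    rw [jSum_eq h0 hE hJ0 hJ, Finset.sum_add_distrib]
    have hA : ∑ q ∈ Finset.range (b + 1), (((m + 2 : ℕ) : S) - q) * (E q * e (b + 1 + (m + 2) - q)) =
        s1 + s0 := by
      rw [hs1, hs0, ← Finset.sum_add_distrib]
      refine Finset.sum_congr rfl fun q _ => ?_
      rw [show b + 1 + (m + 2) = b + m + 3 by ring, hPdef]
      push_cast
      ring
    have hB : ∑ q ∈ Finset.range (b + 1), (((b + 1 : ℕ) : S) - q) * (E (b + 1 + (m + 2) - q) * e q) =
        (b + 1) * P (b + m + 3) + t1 := by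
      rw [← ht1', Finset.sum_range_succ', Finset.sum_range_succ _ b, sub_self, zero_mul, add_zero,
        add_comm]
      congr 1
      · rw [hPdef]
        dsimp only
        rw [Nat.sub_self, Nat.sub_zero, show b + 1 + (m + 2) = b + m + 3 by ring]
        push_cast
        ring
      · refine Finset.sum_congr rfl fun q _ => ?_
        rw [show b + 1 + (m + 2) - (q + 1) = b + m + 2 - q by omega]
        push_cast
        ring
    rw [hA, hB, hPdef]
    dsimp only
    rw [show b + m + 3 - (b + 1) = m + 2 by omega]
    push_cast
    ring
  have h4 : y * (E (b + 1) * e (m + 1)) = R (b + 1) - P (b + 1) := by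
    rw [← hyP (b + 1) (by omega), show b + m + 2 - (b + 1) = m + 1 by omega]
  have h3 : y * (y * (e b * e (m + 1))) = R (b + 1) - R 0 - t0 + s0 := by
    rw [mul_shift_eq_sum h0 hE, Finset.mul_sum, ← ht0', hs0, ← Finset.sum_range_sub R,
      ← Finset.sum_sub_distrib, ← Finset.sum_add_distrib]
    refine Finset.sum_congr rfl fun q hq => ?_
    have := Finset.mem_range.1 hq
    rw [show b + 1 + (m + 1) = b + m + 2 by ring]
    linear_combination hyP' q - hyP q (by omega)
  have h2 : y * J (b + 1) (m + 1) = (b + 1) * (R (b + 1) - P (b + 1)) -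
      ((m + 1) * R 0 + r + R (b + 1) - s1 - t1 - t0) := by
    have hA : y * ∑ q ∈ Finset.range (b + 1), ((((m + 1 : ℕ) : S) - q) *
        (E q * e (b + 1 + (m + 1) - q)) + (((b + 1 : ℕ) : S) - q) *
        (E (b + 1 + (m + 1) - q) * e q)) =
        ∑ q ∈ Finset.range (b + 1), ((m : S) + 1 - q) * R q +
        ∑ q ∈ Finset.range (b + 1), ((b : S) + 1 - q) * R (q + 1) - s1 - t1 - t0 := by
      rw [Finset.mul_sum, hs1, ← ht1', ← ht0', ← Finset.sum_add_distrib, ← Finset.sum_sub_distrib,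
        ← Finset.sum_sub_distrib, ← Finset.sum_sub_distrib]
      refine Finset.sum_congr rfl fun q hq => ?_
      have := Finset.mem_range.1 hq
      rw [show b + 1 + (m + 1) = b + m + 2 by ring]
      push_cast
      linear_combination ((b : S) + 1 - q) * hyP' q + ((m : S) + 1 - q) * hyP q (by omega)
    have hB : ∑ q ∈ Finset.range (b + 1), ((m : S) + 1 - q) * R q +
        ∑ q ∈ Finset.range (b + 1), ((b : S) + 1 - q) * R (q + 1) =
        (m + 1) * R 0 + r + R (b + 1) := by
      have hC : r = ∑ q ∈ Finset.range b, ((m : S) + 1 - ((q + 1 : ℕ) : S)) * R (q + 1) +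
          ∑ q ∈ Finset.range b, ((b : S) + 1 - q) * R (q + 1) := by
        rw [hr, ← Finset.sum_add_distrib]
        refine Finset.sum_congr rfl fun q _ => ?_
        push_cast
        ring
      rw [hC, Finset.sum_range_succ', Finset.sum_range_succ _ b]
      push_cast
      ring
    rw [jSum_eq h0 hE hJ0 hJ, mul_sub, hA, hB]
    push_cast
    linear_combination ((b : S) + 1) * h4
  have key : peakPoly e E y J m b j κ =
      (((l + i) * (i + 1) * (b + 1) : ℕ) : S) * P (b + 1) +
      (((m + 1) * (j + 1) * (b + 1) : ℕ) : S) * P (b + m + 3) +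
      (∑ q ∈ Finset.range (b + 1), (((m : S) + 1 - q) * (((m + 1) * l + κ * (i + 1) : ℕ) : S) +
          (((m + 1) * l : ℕ) : S)) * P q +
        ∑ q ∈ Finset.range (b + 1), ((q : S) * (((m + 1) * l + κ * (i + 1) : ℕ) : S) +
          ((κ * (i + 1) : ℕ) : S)) * P (m + 2 + q)) +
      ((κ * ((m + 1) * (j + 1)) : ℕ) : S) * R 0 + ((κ * j : ℕ) : S) * r +
      ((κ * ((i + 1) * b) : ℕ) : S) * R (b + 1) := by
    have hX : ∀ X U V : S,
        ∑ q ∈ Finset.range (b + 1), (((m : S) + 1 - q) * X + U) * P q +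
          ∑ q ∈ Finset.range (b + 1), ((q : S) * X + V) * P (m + 2 + q) =
        X * s1 + U * s0 + X * t1 + V * t0 := by
      intro X U V
      rw [hs1, hs0, ht1, ht0]
      simp only [Finset.mul_sum, ← Finset.sum_add_distrib]
      refine Finset.sum_congr rfl fun q _ => ?_
      ring
    have h5 : E (b + 1) * e (m + 2) = P (b + 1) := by
      rw [hPdef]
      dsimp only
      rw [show b + m + 3 - (b + 1) = m + 2 by omega]
    rw [hX, peakPoly, h5, h1]
    push_cast
    have hl' : (l : S) = j + 1 - κ := by rw [hlS]; ring
    rw [hl', hmS] at *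
    linear_combination (κ : S) * (((j : S) + i + 1) * (b + 1) * h4 - (j + i + 1) * h3 - j * h2)
  rw [key]
  have hlin := linear_cancel_mem (C := C) (P := P) m b ((m + 1) * l + κ * (i + 1)) ((m + 1) * l)
    (κ * (i + 1)) rfl hP
  exact C.add_mem (C.add_mem (C.add_mem (C.add_mem (C.add_mem
    (natCast_mul_mem (hP _ (by omega)) _) (natCast_mul_mem (hP _ le_rfl) _)) hlin)
    (natCast_mul_mem (hR _ (by omega)) _)) (natCast_mul_mem (antisymm_cancel_mem m b hR) _))
    (natCast_mul_mem (hR _ (by omega)) _)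

/-- The part of `esum x D r` coming from the subsets that contain `c`. -/
def markedEsum {A R : Type*} [CommRing R] (x : A → R) (D : Finset A) (c : A) : ℕ → R
  | 0 => 0
  | r + 1 => x c * esum x (D.erase c) r

theorem markedEsum_succ {A R : Type*} [CommRing R] (x : A → R) {D : Finset A} {c : A} (hc : c ∈ D)
    (r : ℕ) : markedEsum x D c (r + 1) = x c * (esum x D r - markedEsum x D c r) := by
  cases r with
  | zero => simp [markedEsum, esum_zero]
  | succ r => rw [esum_succ x hc]; simp [markedEsum]

theorem sum_markedEsum_succ {A R : Type*} [CommRing R] (x : A → R) (D : Finset A) (r : ℕ) :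
    ∑ c ∈ D, markedEsum x D c (r + 1) = (r + 1 : ℕ) * esum x D (r + 1) :=
  sum_mul_esum_erase x D r

/-- The sum over `c` of the products of two marked elementary sums. -/
def pairEsum {A R : Type*} [CommRing R] (x : A → R) (D : Finset A) (r s : ℕ) : R :=
  ∑ c ∈ D, markedEsum x D c r * markedEsum x D c s

theorem pairEsum_zero {A R : Type*} [CommRing R] (x : A → R) (D : Finset A) (s : ℕ) :
    pairEsum x D 0 s = 0 := by
  simp [pairEsum, markedEsum]

theorem pairEsum_succ {A R : Type*} [CommRing R] (x : A → R) (D : Finset A) (r s : ℕ) :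
    pairEsum x D (r + 1) s = pairEsum x D r (s + 1) + (r + 1) * (esum x D (r + 1) * esum x D s) -
      (s + 1) * (esum x D r * esum x D (s + 1)) := by
  have h : pairEsum x D (r + 1) s = pairEsum x D r (s + 1) +
      esum x D s * ∑ c ∈ D, markedEsum x D c (r + 1) -
      esum x D r * ∑ c ∈ D, markedEsum x D c (s + 1) := by
    unfold pairEsum
    rw [Finset.mul_sum, Finset.mul_sum, ← Finset.sum_add_distrib, ← Finset.sum_sub_distrib]
    refine Finset.sum_congr rfl fun c hc => ?_
    rw [markedEsum_succ x hc, markedEsum_succ x hc]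
    ring
  rw [h, sum_markedEsum_succ, sum_markedEsum_succ]
  push_cast
  ring

/-- The variant of `pairEsum` in which the first factor may also use the letter `c'`. -/
def extendedPairEsum {A R : Type*} [Fintype A] [CommRing R] (x : A → R) (c' : A) : ℕ → ℕ → R
  | 0, _ => 0
  | b + 1, s => pairEsum x (Finset.univ.erase c') (b + 1) s +
      x c' * pairEsum x (Finset.univ.erase c') b s

theorem extendedPairEsum_succ {A R : Type*} [Fintype A] [CommRing R] (x : A → R) (c' : A) (b s : ℕ) :
    extendedPairEsum x c' (b + 1) s = extendedPairEsum x c' b (s + 1) +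
      (b + 1) * (esum x Finset.univ (b + 1) * esum x (Finset.univ.erase c') s) -
      (s + 1) * (esum x Finset.univ b * esum x (Finset.univ.erase c') (s + 1)) -
      x c' * (esum x (Finset.univ.erase c') b * esum x (Finset.univ.erase c') s) := by
  cases b with
  | zero =>
    simp only [extendedPairEsum]
    rw [pairEsum_succ, pairEsum_zero, pairEsum_zero, esum_succ x (Finset.mem_univ c'), esum_zero,
      esum_zero]
    push_cast
    ring
  | succ b =>
    simp only [extendedPairEsum]
    rw [pairEsum_succ x _ (b + 1), pairEsum_succ x _ b s, esum_succ x (Finset.mem_univ c'),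
      esum_succ x (Finset.mem_univ c') b]
    push_cast
    ring

theorem mul_esum_erase_eq {A R : Type*} [Fintype A] [CommRing R] (x : A → R) {c c' : A}
    (h : c ∈ Finset.univ.erase c') (b : ℕ) :
    x c * esum x (Finset.univ.erase c) b = markedEsum x (Finset.univ.erase c') c (b + 1) +
      x c' * markedEsum x (Finset.univ.erase c') c b := by
  cases b with
  | zero => simp [markedEsum, esum_zero]
  | succ b =>
    have h' : c' ∈ Finset.univ.erase c :=
      Finset.mem_erase.2 ⟨(Finset.ne_of_mem_erase h).symm, Finset.mem_univ _⟩
    rw [esum_succ x h', Finset.erase_right_comm]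
    simp only [markedEsum]
    ring

theorem sum_esum_mul_stpWeight {A R : Type*} [Fintype A] [CommRing R] (x : A → R) (m b j κ : ℕ)
    (c' : A) :
    ∑ c, esum x (Finset.univ.erase c) b * (x c * stpWeight x m j κ c c') =
      m.factorial * peakPoly (esum x (Finset.univ.erase c')) (esum x Finset.univ) (x c')
        (extendedPairEsum x c') m b j κ := by
  set D := Finset.univ.erase c' with hD
  have hfac : (((m + 1).factorial : ℕ) : R) = (m + 1) * m.factorial := by
    rw [Nat.factorial_succ]; push_cast; ring
  have hfac2 : (((m + 2).factorial : ℕ) : R) = (m + 2) * ((m + 1) * m.factorial) := by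
    rw [Nat.factorial_succ, Nat.cast_mul, hfac]; push_cast; ring
  have htot : ∑ c, x c * esum x (Finset.univ.erase c) b = (b + 1) * esum x Finset.univ (b + 1) := by
    rw [sum_mul_esum_erase]; push_cast; ring
  have hD1 : ∑ c ∈ D, (markedEsum x D c (b + 1) + x c' * markedEsum x D c b) =
      (b + 1) * esum x Finset.univ (b + 1) - x c' * esum x D b := by
    rw [← htot, ← Finset.add_sum_erase _ _ (Finset.mem_univ c'), add_sub_cancel_left]
    exact Finset.sum_congr rfl fun c hc => (mul_esum_erase_eq x hc b).symm
  have hD2 : ∀ s, ∑ c ∈ D, (markedEsum x D c (b + 1) + x c' * markedEsum x D c b) *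
      markedEsum x D c s = extendedPairEsum x c' (b + 1) s := by
    intro s
    simp only [extendedPairEsum, pairEsum, Finset.mul_sum, ← Finset.sum_add_distrib]
    refine Finset.sum_congr rfl fun c _ => ?_
    ring
  have hW : ∀ c, esum x (Finset.univ.erase c) b * (x c * stpWeight x m j κ c c') =
      (m + 2).factorial * esum x D (m + 2) * (x c * esum x (Finset.univ.erase c) b) +
      if c ∈ D then (markedEsum x D c (b + 1) + x c' * markedEsum x D c b) *
        (κ * (x c' * ((m + 1).factorial * esum x D (m + 1) -
          j * m.factorial * markedEsum x D c (m + 1))) -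
        (j + 1) * (m + 1).factorial * markedEsum x D c (m + 2)) else 0 := by
    intro c
    unfold stpWeight
    rw [← hD]
    split_ifs with hc
    · rw [← mul_esum_erase_eq x hc]
      simp only [markedEsum]
      push_cast
      ring
    · ring
  rw [Finset.sum_congr rfl fun c _ => hW c, Finset.sum_add_distrib, ← Finset.mul_sum, htot,
    Finset.sum_ite_mem, Finset.univ_inter]
  have hS : ∑ c ∈ D, (markedEsum x D c (b + 1) + x c' * markedEsum x D c b) *
        (κ * (x c' * ((m + 1).factorial * esum x D (m + 1) -
          j * m.factorial * markedEsum x D c (m + 1))) -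
        (j + 1) * (m + 1).factorial * markedEsum x D c (m + 2)) =
      κ * x c' * (m + 1).factorial * esum x D (m + 1) *
        ∑ c ∈ D, (markedEsum x D c (b + 1) + x c' * markedEsum x D c b) -
      κ * x c' * j * m.factorial * ∑ c ∈ D, (markedEsum x D c (b + 1) + x c' * markedEsum x D c b) *
        markedEsum x D c (m + 1) -
      (j + 1) * (m + 1).factorial * ∑ c ∈ D, (markedEsum x D c (b + 1) + x c' * markedEsum x D c b) *
        markedEsum x D c (m + 2) := by
    simp only [Finset.mul_sum, ← Finset.sum_sub_distrib]
    refine Finset.sum_congr rfl fun c _ => ?_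
    ring
  rw [hS, hD1, hD2, hD2, hfac, hfac2, peakPoly]
  ring

/-- The data needed to evaluate a marked sum: a finite alphabet, its weights and the colour of
the distinguished vertex. -/
structure MarkedAlphabet (d : ℕ) where
  A : Type
  [fintypeA : Fintype A]
  col : A → ℕ+
  col_injective : Function.Injective col
  x : A → MvPolynomial (Fin d) ℚ
  c : A

attribute [instance] MarkedAlphabet.fintypeA

/-- The family of all marked sums of a coefficient function. -/
def genFun {d : ℕ} (a : Fin d) : Md d →ₗ[ℚ] (MarkedAlphabet d → MvPolynomial (Fin d) ℚ) :=
  LinearMap.pi fun D => markedSum D.col D.x a D.c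

theorem genFun_apply {d : ℕ} (a : Fin d) (f : Md d) (D : MarkedAlphabet d) :
    genFun a f D = markedSum D.col D.x a D.c f := rfl

/-- The cone generated by the families of marked sums of the `eSP π`. -/
def eCone {d : ℕ} (a : Fin d) : AddSubmonoid (MarkedAlphabet d → MvPolynomial (Fin d) ℚ) where
  carrier := {z | ∃ c : SetPtn d → ℚ, (∀ π, 0 ≤ c π) ∧ z = ∑ π, c π • genFun a (eSP π)}
  zero_mem' := ⟨0, fun _ => le_rfl, by simp⟩
  add_mem' := by
    rintro _ _ ⟨c₁, h₁, rfl⟩ ⟨c₂, h₂, rfl⟩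
    exact ⟨c₁ + c₂, fun π => add_nonneg (h₁ π) (h₂ π), by
      simp only [Pi.add_apply, add_smul, Finset.sum_add_distrib]⟩

theorem smul_mem_eCone {d : ℕ} {a : Fin d} {z : MarkedAlphabet d → MvPolynomial (Fin d) ℚ}
    (hz : z ∈ eCone a) {r : ℚ} (hr : 0 ≤ r) : r • z ∈ eCone a := by
  obtain ⟨c, hc, rfl⟩ := hz
  exact ⟨fun π => r * c π, fun π => mul_nonneg hr (hc π), by simp only [Finset.smul_sum, mul_smul]⟩

theorem genFun_eSP_mem_eCone {d : ℕ} (a : Fin d) (π : SetPtn d) : genFun a (eSP π) ∈ eCone a :=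
  ⟨fun ρ => if ρ = π then 1 else 0, fun ρ => by dsimp only; split_ifs <;> norm_num, by simp⟩

theorem typeGF_mem_eCone {d : ℕ} (a : Fin d) (l : Multiset ℕ) (s : ℕ) (h : l.sum + (s + 1) = d) :
    (fun D : MarkedAlphabet d => typeGF D.x D.c l s) ∈ eCone a := by
  obtain ⟨π, hπ⟩ := exists_eSP_markedSum a l s h
  convert genFun_eSP_mem_eCone a π using 1
  funext D
  rw [genFun_apply, hπ _ _ _ _ _ D.col_injective]

theorem isEPosNCAt_of_genFun_mem {d : ℕ} {G : SimpleGraph (Fin d)} {a : Fin d}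
    (h : genFun a (YG G) ∈ eCone a) : IsEPosNCAt G a := by
  obtain ⟨c, hc, hY⟩ := h
  refine ⟨Finset.univ, c, hc, mem_Ksub_of_markedSum_eq_zero a ?_ ?_⟩
  · exact Submodule.sub_mem _ (YG_mem_eSpan G) (Submodule.sum_mem _ fun π _ =>
      Submodule.smul_mem _ _ (Submodule.subset_span ⟨π, rfl⟩))
  · intro A _ col x c' hcol
    have h1 := congrFun hY ⟨A, col, hcol, x, c'⟩
    rw [Finset.sum_apply] at h1
    rw [map_sub, map_sum, sub_eq_zero]
    refine h1.trans (Finset.sum_congr rfl fun π _ => ?_)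
    rw [map_smul]
    rfl

theorem ptype_sum {d : ℕ} (π : SetPtn d) (a : Fin d) :
    (ptype π a).1.sum + ((ptype π a).2 - 1 + 1) = d := by
  have hmem : blockOf π a ∈ π.parts := by
    rw [blockOf_eq_part]
    exact π.part_mem.2 (Finset.mem_univ a)
  have hpos : 0 < (blockOf π a).card := Finset.card_pos.2 (π.nonempty_of_mem_parts hmem)
  have h := π.sum_card_parts
  rw [Finset.card_univ, Fintype.card_fin, ← Finset.sum_erase_add _ _ hmem] at h
  change ∑ B ∈ π.parts.erase (blockOf π a), B.card + ((blockOf π a).card - 1 + 1) = d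
  omega

theorem smul_natCast_mul {R : Type*} [CommRing R] [Algebra ℚ R] {r : ℚ} {N K : ℕ}
    (h : r * N = K) (z : R) : r • ((N : R) * z) = (K : R) * z := by
  have h1 : ∀ k : ℕ, (k : R) * z = (k : ℚ) • z := fun k => by
    rw [Nat.cast_smul_eq_nsmul, nsmul_eq_mul]
  rw [h1, h1, smul_smul, h]

theorem sum_typeGF_mul_stpWeight_mem {p m j κ b : ℕ} (hj : j ≤ m) (hκ : κ ≤ j + 1)
    (a : Fin (p + (m + 3))) (l : Multiset ℕ) (hl : l.sum + (b + 1) = p) :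
    (fun D : MarkedAlphabet (p + (m + 3)) =>
      ∑ c, typeGF D.x c l b * (D.x c * stpWeight D.x m j κ c D.c)) ∈ eCone a := by
  let E : ℕ → MarkedAlphabet (p + (m + 3)) → MvPolynomial (Fin (p + (m + 3))) ℚ :=
    fun r D => esum D.x Finset.univ r
  let e : ℕ → MarkedAlphabet (p + (m + 3)) → MvPolynomial (Fin (p + (m + 3))) ℚ :=
    fun r D => esum D.x (Finset.univ.erase D.c) r
  let y : MarkedAlphabet (p + (m + 3)) → MvPolynomial (Fin (p + (m + 3))) ℚ := fun D => D.x D.c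
  let J : ℕ → ℕ → MarkedAlphabet (p + (m + 3)) → MvPolynomial (Fin (p + (m + 3))) ℚ :=
    fun r s D => extendedPairEsum D.x D.c r s
  let M : MarkedAlphabet (p + (m + 3)) → MvPolynomial (Fin (p + (m + 3))) ℚ := fun D =>
    (b.factorial * m.factorial : ℕ) *
      (l.map fun i => (i.factorial : MvPolynomial (Fin (p + (m + 3))) ℚ) *
        esum D.x Finset.univ i).prod
  have hmain : peakPoly e E y J m b j κ ∈ (eCone a).comap (AddMonoidHom.mulLeft M) := by
    refine peakPoly_mem ?_ ?_ ?_ ?_ hj hκ ?_ ?_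
    · funext D
      simp only [E, e, esum_zero]
    · intro r
      funext D
      exact esum_succ D.x (Finset.mem_univ D.c) r
    · intro s
      rfl
    · intro r s
      funext D
      exact extendedPairEsum_succ D.x D.c r s
    · intro t ht
      have h1 := typeGF_mem_eCone a (t ::ₘ l) (b + m + 3 - t) (by rw [Multiset.sum_cons]; omega)
      have h2 := smul_mem_eCone h1 (r := (b.factorial * m.factorial : ℕ) /
        (t.factorial * (b + m + 3 - t).factorial : ℕ)) (by positivity)
      rw [AddSubmonoid.mem_comap]
      convert h2 using 1
      funext D
      have h3 := smul_natCast_mul (R := MvPolynomial (Fin (p + (m + 3))) ℚ)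
        (r := (b.factorial * m.factorial : ℕ) /
        (t.factorial * (b + m + 3 - t).factorial : ℕ))
        (N := t.factorial * (b + m + 3 - t).factorial) (K := b.factorial * m.factorial)
        (div_mul_cancel₀ _ (by positivity))
        ((l.map fun i => (i.factorial : MvPolynomial (Fin (p + (m + 3))) ℚ) *
          esum D.x Finset.univ i).prod * (E t D * e (b + m + 3 - t) D))
      simp only [Pi.smul_apply, typeGF, Multiset.map_cons, Multiset.prod_cons]
      refine Eq.trans ?_ (h3.symm.trans ?_)
      · simp only [M, AddMonoidHom.coe_mulLeft, Pi.mul_apply]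
        ring
      · congr 1
        simp only [E, e]
        push_cast
        ring
    · intro t ht
      have h1 := typeGF_mem_eCone a (t ::ₘ (b + m + 3 - t) ::ₘ l) 0
        (by rw [Multiset.sum_cons, Multiset.sum_cons]; omega)
      have h2 := smul_mem_eCone h1 (r := (b.factorial * m.factorial : ℕ) /
        (t.factorial * (b + m + 3 - t).factorial : ℕ)) (by positivity)
      rw [AddSubmonoid.mem_comap]
      convert h2 using 1
      funext D
      have h3 := smul_natCast_mul (R := MvPolynomial (Fin (p + (m + 3))) ℚ)
        (r := (b.factorial * m.factorial : ℕ) /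
        (t.factorial * (b + m + 3 - t).factorial : ℕ))
        (N := t.factorial * (b + m + 3 - t).factorial) (K := b.factorial * m.factorial)
        (div_mul_cancel₀ _ (by positivity))
        ((l.map fun i => (i.factorial : MvPolynomial (Fin (p + (m + 3))) ℚ) *
          esum D.x Finset.univ i).prod * (E t D * E (b + m + 3 - t) D))
      simp only [Pi.smul_apply, typeGF, Multiset.map_cons, Multiset.prod_cons]
      refine Eq.trans ?_ (h3.symm.trans ?_)
      · simp only [M, AddMonoidHom.coe_mulLeft, Pi.mul_apply]
        ring
      · congr 1
        simp only [E, esum_zero, Nat.factorial_zero]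
        push_cast
        ring
  rw [AddSubmonoid.mem_comap] at hmain
  convert hmain using 1
  funext D
  have h1 := sum_esum_mul_stpWeight D.x m b j κ D.c
  have h2 : peakPoly e E y J m b j κ D = peakPoly (esum D.x (Finset.univ.erase D.c))
      (esum D.x Finset.univ) (D.x D.c) (extendedPairEsum D.x D.c) m b j κ := rfl
  simp only [M, AddMonoidHom.coe_mulLeft, Pi.mul_apply]
  rw [h2, Nat.cast_mul]
  calc _ = (b.factorial * (l.map fun i => (i.factorial : MvPolynomial (Fin (p + (m + 3))) ℚ) *
        esum D.x Finset.univ i).prod) * ∑ c, esum D.x (Finset.univ.erase c) b *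
          (D.x c * stpWeight D.x m j κ c D.c) := by
        rw [Finset.mul_sum]
        refine Finset.sum_congr rfl fun c _ => ?_
        rw [typeGF]
        ring
    _ = _ := by
        rw [h1]
        ring

theorem isEPosNCAt_concatG {p m j κ : ℕ} (hp : 0 < p) (hj : j ≤ m) (hκ : κ ≤ j + 1)
    {G : SimpleGraph (Fin p)} (hG : IsEPosNCAt G ⟨p - 1, by omega⟩) {H : SimpleGraph (Fin (m + 4))}
    (hH : ∀ (A R : Type) [Fintype A] [CommRing R] [Algebra ℚ R] (col : A → ℕ+) (x : A → R)
      (c c' : A), Function.Injective col →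
        transfer (N := m + 2) col x H c c' = stpWeight x m j κ c c') :
    IsEPosNCAt (d := p + (m + 3)) (concatG G H) (Fin.natAdd p (Fin.last (m + 2))) := by
  obtain ⟨s, k, hk, hK⟩ := hG
  apply isEPosNCAt_of_genFun_mem
  have h : genFun (Fin.natAdd p (Fin.last (m + 2))) (YG (d := p + (m + 3)) (concatG G H)) =
      ∑ π ∈ s, k π • fun D : MarkedAlphabet (p + (m + 3)) =>
        ∑ c, typeGF D.x c (ptype π ⟨p - 1, by omega⟩).1 ((ptype π ⟨p - 1, by omega⟩).2 - 1) *
          (D.x c * stpWeight D.x m j κ c D.c) := by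
    funext D
    have h1 : ∀ c, markedSum D.col D.x ⟨p - 1, by omega⟩ c (YG G) = ∑ π ∈ s, k π •
        typeGF D.x c (ptype π ⟨p - 1, by omega⟩).1 ((ptype π ⟨p - 1, by omega⟩).2 - 1) := by
      intro c
      have h2 := markedSum_eq_zero_of_mem_Ksub D.col_injective D.x c hK
      rw [map_sub, sub_eq_zero, map_sum] at h2
      rw [h2]
      refine Finset.sum_congr rfl fun π _ => ?_
      rw [map_smul, markedSum_eSP D.col_injective]
    rw [genFun_apply, markedSum_concatG hp, Finset.sum_apply]
    simp only [h1, hH _ _ _ _ _ _ D.col_injective, Pi.smul_apply, Finset.sum_mul, Finset.smul_sum,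
      smul_mul_assoc]
    exact Finset.sum_comm
  rw [h]
  exact AddSubmonoid.sum_mem _ fun π _ => smul_mem_eCone
    (sum_typeGF_mul_stpWeight_mem hj hκ _ _ (ptype_sum π _)) (hk π)

theorem stmt7 (n k : ℕ) (hn : 3 ≤ n) (hk1 : 1 ≤ k) (hk2 : k ≤ n - 2) :
    (LGraph.mk (n + 1) (by omega) (STPgraph n k)).Appendable ∧
    (LGraph.mk (n + 1) (by omega) (revG (STPgraph n k))).Appendable := by
  obtain ⟨m, rfl⟩ : ∃ m, n = m + 3 := ⟨n - 3, by omega⟩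
  obtain ⟨j, rfl⟩ : ∃ j, k = j + 1 := ⟨k - 1, by omega⟩
  have hj : j ≤ m := by omega
  have key : ∀ (H : SimpleGraph (Fin (m + 4))) (A : LGraph),
      IsEPosNCAt (d := A.n + (m + 3)) (concatG A.G H) (Fin.natAdd A.n (Fin.last (m + 2))) →
      (A.concat ⟨m + 4, by omega, H⟩).EPosNC := fun H A h => h
  exact ⟨fun A hA => key _ A (isEPosNCAt_concatG A.npos hj (κ := 1) (by omega) hA
      fun _ _ _ _ _ _ x c c' hcol => transfer_STP hcol x hj c c'),
    fun A hA => key _ A (isEPosNCAt_concatG A.npos le_rfl (κ := m + 1 - j) (by omega) hA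
      fun _ _ _ _ _ _ x c c' hcol => transfer_revG_STP hcol x hj c c')⟩
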